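/- Let F be a non-abelian free group of finite rank and let H_1, …, H_n be finitely many finitely generated subgroups of F, each of infinite index in F. Let U be a finite subgroup of Out(F), let π : Aut(F) → Out(F) be the quotient map, and put A = π⁻¹(U). Then there exists a proper subgroup H of F satisfying: (i) H is a free subgroup of rank two and is malnormal in F; (ii) for every l ∈ {1, …, n} and every a ∈ A, the intersection H_l ∩ a(H) is trivial; (iii) for every a ∈ A, either a(H) = H or the intersection H ∩ a(H) is trivial. -/

import Mathlib

/-- The conjugate subgroup `g H g⁻¹`. -/
def conjSub {G : Type*} [Group G] (g : G) (H : Subgroup G) : Subgroup G :=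
  H.map (MulAut.conj g).toMonoidHom

/-- A subgroup `H` of `G` is malnormal if for every `g ∉ H` the
intersection `H ∩ gHg⁻¹` is trivial. -/
def Malnormal {G : Type*} [Group G] (H : Subgroup G) : Prop :=
  ∀ g : G, g ∉ H → H ⊓ conjSub g H = ⊥


namespace Kap

section Geometry
variable {α : Type*} [DecidableEq α]

/-- length of the common prefix -/
def cp {β : Type*} [DecidableEq β] : List β → List β → ℕ
  | a :: l, b :: m => if a = b then cp l m + 1 else 0
  | _, _ => 0

lemma cp_ultra {β : Type*} [DecidableEq β] (l m k : List β) :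
    cp l m ≤ cp l k ∨ cp m k ≤ cp l k := by
  induction l generalizing m k with
  | nil => left; simp [cp]
  | cons a l ih =>
    cases m with
    | nil => left; simp [cp]
    | cons b m =>
      cases k with
      | nil => right; simp [cp]
      | cons c k =>
        simp only [cp]
        by_cases h1 : a = b
        · by_cases h2 : b = c
          · have h3 : a = c := h1.trans h2
            rcases ih m k with h | h
            · left; simp [h1, h3]; split_ifs <;> omega
            · right; simp [h2, h3, h]
          · right; simp [h2]
        · left; simp [h1]

lemma isReduced_invRev {l : List (α × Bool)} (h : FreeGroup.IsReduced l) :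
    FreeGroup.IsReduced (FreeGroup.invRev l) := by
  rw [FreeGroup.isReduced_iff_reduce_eq] at *
  rw [FreeGroup.reduce_invRev, h]

lemma norm_mk_of_reduced {l : List (α × Bool)} (h : FreeGroup.IsReduced l) :
    FreeGroup.norm (FreeGroup.mk l) = l.length := by
  rw [FreeGroup.norm, FreeGroup.toWord_mk, h.reduce_eq]

lemma mk_cons (a : α × Bool) (l : List (α × Bool)) :
    FreeGroup.mk (a :: l) = FreeGroup.mk [a] * FreeGroup.mk l := by
  rw [FreeGroup.mul_mk]; rfl

lemma norm_inv_mul_cp (l m : List (α × Bool)) (hl : FreeGroup.IsReduced l)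
    (hm : FreeGroup.IsReduced m) :
    FreeGroup.norm ((FreeGroup.mk l)⁻¹ * FreeGroup.mk m) + 2 * cp l m = l.length + m.length := by
  induction l generalizing m with
  | nil => 
    have : (FreeGroup.mk ([] : List (α × Bool))) = 1 := rfl
    simp [cp, this, norm_mk_of_reduced hm]
  | cons a l ih =>
    cases m with
    | nil =>
      have : (FreeGroup.mk ([] : List (α × Bool))) = 1 := rfl
      simp [cp, this, FreeGroup.norm_inv_eq, norm_mk_of_reduced hl, -FreeGroup.inv_mk]
    | cons b m =>
      by_cases hab : a = b
      · subst hab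
        rw [mk_cons a l, mk_cons a m]
        have h1 := ih m (List.IsChain.tail hl) (List.IsChain.tail hm)
        have h2 : (FreeGroup.mk [a] * FreeGroup.mk l)⁻¹ * (FreeGroup.mk [a] * FreeGroup.mk m)
          = (FreeGroup.mk l)⁻¹ * FreeGroup.mk m := by group
        rw [h2]
        simp only [cp, if_true, List.length_cons]; omega
      · rw [FreeGroup.inv_mk, FreeGroup.mul_mk, norm_mk_of_reduced]
        · simp [cp, hab]
        · apply List.isChain_append.2 ⟨isReduced_invRev hl, hm, ?_⟩
          intro x hx y hy
          simp [FreeGroup.invRev] at hx hy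
          subst hx; subst hy
          intro h
          by_contra h'
          apply hab
          ext
          · exact h
          · simp at h'; simpa using h'

/-- integer norm -/
def nm (x : FreeGroup α) : ℤ := (FreeGroup.norm x : ℤ)
/-- the tree distance -/
def ds (x y : FreeGroup α) : ℤ := nm (x⁻¹ * y)

lemma nm_nonneg (x : FreeGroup α) : 0 ≤ nm x := by simp [nm]
lemma ds_nonneg (x y : FreeGroup α) : 0 ≤ ds x y := nm_nonneg _
@[simp] lemma nm_one : nm (1 : FreeGroup α) = 0 := by simp [nm]
@[simp] lemma nm_inv (x : FreeGroup α) : nm x⁻¹ = nm x := by simp [nm, FreeGroup.norm_inv_eq]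
lemma nm_eq_zero {x : FreeGroup α} : nm x = 0 ↔ x = 1 := by simp [nm]
lemma nm_mul_le (x y : FreeGroup α) : nm (x * y) ≤ nm x + nm y := by
  unfold nm; exact_mod_cast FreeGroup.norm_mul_le x y
@[simp] lemma ds_self (x : FreeGroup α) : ds x x = 0 := by simp [ds]
lemma ds_comm (x y : FreeGroup α) : ds x y = ds y x := by
  rw [ds, ds, ← nm_inv]; simp
lemma ds_tri (x y z : FreeGroup α) : ds x z ≤ ds x y + ds y z := by
  have := nm_mul_le (x⁻¹ * y) (y⁻¹ * z)
  have h : x⁻¹ * y * (y⁻¹ * z) = x⁻¹ * z := by group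
  rw [h] at this; exact this
@[simp] lemma ds_mul_left (g x y : FreeGroup α) : ds (g * x) (g * y) = ds x y := by
  unfold ds; congr 1; group
lemma ds_one_left (x : FreeGroup α) : ds 1 x = nm x := by simp [ds]
lemma ds_one_right (x : FreeGroup α) : ds x 1 = nm x := by simp [ds]
lemma ds_mul_right (x y : FreeGroup α) : ds x (x * y) = nm y := by simp [ds]

lemma nm_cp (x y : FreeGroup α) : ds x y + 2 * (cp x.toWord y.toWord : ℕ) = nm x + nm y := by
  have := norm_inv_mul_cp x.toWord y.toWord FreeGroup.isReduced_toWord FreeGroup.isReduced_toWord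
  rw [FreeGroup.mk_toWord, FreeGroup.mk_toWord] at this
  unfold ds nm FreeGroup.norm
  unfold FreeGroup.norm at this
  exact_mod_cast this

lemma four (x y z w : FreeGroup α) :
    ds x y + ds z w ≤ ds x z + ds y w ∨ ds x y + ds z w ≤ ds x w + ds y z := by
  have e : ∀ a b : FreeGroup α, ds a b = ds (w⁻¹ * a) (w⁻¹ * b) := by intro a b; simp
  have e2 : ∀ a : FreeGroup α, ds a w = nm (w⁻¹ * a) := by
    intro a; rw [ds_comm]; rfl
  rw [e x y, e x z, e y z, e2 x, e2 y, e2 z]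
  generalize w⁻¹ * x = x
  generalize w⁻¹ * y = y
  generalize w⁻¹ * z = z
  have h1 := nm_cp x y
  have h2 := nm_cp x z
  have h3 := nm_cp y z
  have h4 := nm_cp z y
  rw [ds_comm z y] at h4
  rcases cp_ultra x.toWord z.toWord y.toWord with h | h
  · left; omega
  · right; omega

/-- coarse path lemma -/
lemma path_near (x : ℕ → FreeGroup α) (n : ℕ) (lam : ℤ) (hlam : 0 ≤ lam)
    (hx : ∀ i < n, ds (x i) (x (i+1)) ≤ lam) (p : FreeGroup α) :
    ∃ i ≤ n, 2 * ds p (x i) ≤ ds p (x 0) + ds p (x n) - ds (x 0) (x n) + 2 * lam := by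
  induction n with
  | zero => exact ⟨0, le_rfl, by simp; omega⟩
  | succ n ih =>
    obtain ⟨i, hi, h⟩ := ih (fun i hi => hx i (by omega))
    have h1 := four (x 0) (x (n+1)) p (x n)
    have h2 := hx n (by omega)
    have h3 := ds_tri p (x (n+1)) (x n)
    rw [ds_comm (x (n+1)) (x n)] at h3 h1
    rw [ds_comm (x 0) p, ds_comm (x (n+1)) p] at h1
    have h4 := ds_tri (x 0) (x n) (x (n+1))
    rcases h1 with h1 | h1
    · refine ⟨n, by omega, ?_⟩
      omega
    · exact ⟨i, by omega, by omega⟩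

/-- points along a reduced word -/
lemma ds_take (L : List (α × Bool)) (hL : FreeGroup.IsReduced L) (i j : ℕ) (hij : i ≤ j)
    (hj : j ≤ L.length) :
    ds (FreeGroup.mk (L.take i)) (FreeGroup.mk (L.take j)) = j - i := by
  have h1 : L.take j = L.take i ++ (L.take j).drop i := by
    conv_lhs => rw [← List.take_append_drop i (L.take j)]
    rw [List.take_take, min_eq_left hij]
  have h2 : FreeGroup.IsReduced ((L.take j).drop i) :=
    List.IsChain.drop (List.IsChain.take hL _) _
  rw [h1, ← FreeGroup.mul_mk, ds_mul_right, nm, norm_mk_of_reduced h2]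
  simp; omega

/-- unit speed geodesics -/
lemma exists_geod (p q : FreeGroup α) : ∃ (n : ℕ) (x : ℕ → FreeGroup α), x 0 = p ∧ x n = q ∧
    (∀ i < n, ds (x i) (x (i+1)) ≤ 1) ∧ ∀ i ≤ n, ds p (x i) + ds (x i) q = ds p q := by
  set L := (p⁻¹ * q).toWord with hLdef
  have hL : FreeGroup.IsReduced L := FreeGroup.isReduced_toWord
  have e0 : p = p * FreeGroup.mk (L.take 0) := by
    have : (FreeGroup.mk ([] : List (α × Bool))) = 1 := rfl
    simp [this]
  have e1 : q = p * FreeGroup.mk (L.take L.length) := by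
    simp [hLdef, FreeGroup.mk_toWord]
  refine ⟨L.length, fun i => p * FreeGroup.mk (L.take i), e0.symm, e1.symm, ?_, ?_⟩
  · intro i hi
    beta_reduce
    rw [ds_mul_left, ds_take L hL i (i+1) (by omega) (by omega)]; push_cast; omega
  · intro i hi
    have : ds p q = L.length := by rw [ds, nm, FreeGroup.norm]
    rw [this]
    have h1 : ds p (p * FreeGroup.mk (L.take i)) = i := by
      conv_lhs => rw [e0, ← e0]
      have := ds_take L hL 0 i (by omega) (by omega)
      conv_lhs => lhs; rw [e0]
      rw [ds_mul_left, this]; simp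
    have h2 : ds (p * FreeGroup.mk (L.take i)) q = L.length - i := by
      conv_lhs => rhs; rw [e1]
      rw [ds_mul_left, ds_take L hL i _ (by omega) le_rfl]
    simp only [h1, h2]; ring

/-- automorphisms are Lipschitz -/
lemma lip [Finite α] (a : FreeGroup α →* FreeGroup α) :
    ∃ lam : ℤ, 1 ≤ lam ∧ ∀ x, nm (a x) ≤ lam * nm x := by
  cases nonempty_fintype α
  set lam : ℤ := 1 + ∑ i : α, nm (a (FreeGroup.of i)) with hlam
  have hi : ∀ i, nm (a (FreeGroup.of i)) ≤ lam := by
    intro i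
    have := Finset.single_le_sum (f := fun i => nm (a (FreeGroup.of i)))
      (fun i _ => nm_nonneg _) (Finset.mem_univ i)
    omega
  refine ⟨lam, ?_, ?_⟩
  · have : 0 ≤ ∑ i : α, nm (a (FreeGroup.of i)) := Finset.sum_nonneg (fun i _ => nm_nonneg _)
    omega
  · have key : ∀ L : List (α × Bool), nm (a (FreeGroup.mk L)) ≤ lam * L.length := by
      intro L
      induction L with
      | nil =>
        have : (FreeGroup.mk ([] : List (α × Bool))) = 1 := rfl
        simp [this]
      | cons c L ih =>
        rw [mk_cons, map_mul]
        have h1 := nm_mul_le (a (FreeGroup.mk [c])) (a (FreeGroup.mk L))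
        have h2 : nm (a (FreeGroup.mk [c])) ≤ lam := by
          rcases c with ⟨i, b⟩
          cases b
          · have : (FreeGroup.mk [(i, false)]) = (FreeGroup.of i)⁻¹ := rfl
            rw [this, map_inv, nm_inv]; exact hi i
          · exact hi i
        push_cast [List.length_cons]
        rw [mul_add]; omega
    intro x
    have := key x.toWord
    rw [FreeGroup.mk_toWord] at this
    exact this

/-- stability of geodesics under automorphisms -/
lemma stab [Finite α] (a : MulAut (FreeGroup α)) :
    ∃ lam C : ℤ, 1 ≤ lam ∧ 0 ≤ C ∧ (∀ x, nm (a x) ≤ lam * nm x) ∧ (∀ x, nm x ≤ lam * nm (a x)) ∧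
      ∀ p q x, ds p x + ds x q = ds p q →
        ds (a p) (a x) + ds (a x) (a q) ≤ ds (a p) (a q) + 2 * C := by
  obtain ⟨l1, hl1, h1⟩ := lip a.toMonoidHom
  obtain ⟨l2, hl2, h2⟩ := lip (a⁻¹ : MulAut (FreeGroup α)).toMonoidHom
  have h1' : ∀ x, nm (a x) ≤ l1 * nm x := h1
  have h2' : ∀ x, nm (a⁻¹ x) ≤ l2 * nm x := h2
  have hd1 : ∀ x y, ds (a x) (a y) ≤ l1 * ds x y := by
    intro x y; unfold ds; rw [← map_inv, ← map_mul]; exact h1' _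
  have hd2 : ∀ x y, ds (a⁻¹ x) (a⁻¹ y) ≤ l2 * ds x y := by
    intro x y; unfold ds; rw [← map_inv, ← map_mul]; exact h2' _
  refine ⟨l1 + l2, l1 * l2, by omega, by positivity, ?_, ?_, ?_⟩
  · intro x; have := h1' x; have := nm_nonneg x; nlinarith
  · intro x; have := h2' (a x)
    rw [MulAut.inv_apply_self] at this
    have := nm_nonneg (a x); nlinarith
  · intro p q x hx
    obtain ⟨n, y, hy0, hyn, hstep, hgeo⟩ := exists_geod (a p) (a q)
    obtain ⟨i, hi, h⟩ := path_near (fun i => a⁻¹ (y i)) n l2 (by omega)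
      (by intro i hi
          have := hd2 (y i) (y (i+1))
          have h3 := hstep i hi
          nlinarith) x
    simp only [hy0, hyn, MulAut.inv_apply_self] at h
    have h4 : ds x (a⁻¹ (y i)) ≤ l2 := by rw [ds_comm x p] at h; omega
    have h5 := hd1 x (a⁻¹ (y i))
    rw [MulAut.apply_inv_self] at h5
    have h6 : ds (a x) (y i) ≤ l1 * l2 := by nlinarith
    have h7 := hgeo i hi
    have h8 := ds_tri (a p) (y i) (a x)
    have h9 := ds_tri (a x) (y i) (a q)
    rw [ds_comm (y i) (a x)] at h8
    omega

/-- quasiconvexity of finitely generated subgroups -/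
lemma qconvex (H : Subgroup (FreeGroup α)) (hH : H.FG) :
    ∃ lam : ℤ, 0 ≤ lam ∧ ∀ h ∈ H, ∀ (p : FreeGroup α) (C : ℤ), ds 1 p + ds p h ≤ ds 1 h + 2 * C →
      ∃ k ∈ H, ds p k ≤ C + lam := by
  obtain ⟨S, hS⟩ := hH
  set lam : ℤ := ∑ s ∈ S, nm s with hlam
  have hlam0 : 0 ≤ lam := Finset.sum_nonneg (fun i _ => nm_nonneg _)
  have hs : ∀ s ∈ S, nm s ≤ lam := fun s hs =>
    Finset.single_le_sum (f := fun i => nm i) (fun i _ => nm_nonneg _) hs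
  have key : ∀ h ∈ H, ∃ (n : ℕ) (x : ℕ → FreeGroup α), x 0 = 1 ∧ x n = h ∧
      (∀ i, x i ∈ H) ∧ ∀ i < n, ds (x i) (x (i+1)) ≤ lam := by
    intro h hh
    rw [← hS] at hh
    have step : ∀ (y s : FreeGroup α), y ∈ H → s ∈ H → nm s ≤ lam →
      (∃ (n : ℕ) (x : ℕ → FreeGroup α), x 0 = 1 ∧ x n = y ∧
      (∀ i, x i ∈ H) ∧ ∀ i < n, ds (x i) (x (i+1)) ≤ lam) → 
      (∃ (n : ℕ) (x : ℕ → FreeGroup α), x 0 = 1 ∧ x n = y * s ∧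
      (∀ i, x i ∈ H) ∧ ∀ i < n, ds (x i) (x (i+1)) ≤ lam) := by
      rintro y s hy hs hn ⟨n, x, h0, h1, h2, h3⟩
      refine ⟨n+1, fun i => if i ≤ n then x i else y * s, by simp [h0], by simp, ?_, ?_⟩
      · intro i; dsimp only; split_ifs
        · exact h2 i
        · exact H.mul_mem hy hs
      · intro i hi
        by_cases hin : i < n
        · have : i + 1 ≤ n := hin
          simp only [this, if_true, hin.le]; exact h3 i hin
        · have : i = n := by omega
          subst this
          simp only [le_refl, if_true, h1]
          simp [ds_mul_right, hn]
    have hSH : ∀ s ∈ S, s ∈ H := fun s hs => hS ▸ Subgroup.subset_closure hs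
    induction hh using Subgroup.closure_induction_right with
    | one => exact ⟨0, fun _ => 1, rfl, rfl, fun _ => H.one_mem, by simp⟩
    | mul_right y hy s hs' ih =>
      exact step y s (hS ▸ hy) (hSH s hs') (hs s hs') ih
    | mul_inv_cancel y hy s hs' ih =>
      exact step y s⁻¹ (hS ▸ hy) (H.inv_mem (hSH s hs')) (by rw [nm_inv]; exact hs s hs') ih
  refine ⟨lam, hlam0, ?_⟩
  intro h hh p C hp
  obtain ⟨n, x, h0, h1, h2, h3⟩ := key h hh
  obtain ⟨i, hi, h4⟩ := path_near x n lam hlam0 h3 p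
  refine ⟨x i, h2 i, ?_⟩
  rw [h0, h1] at h4
  rw [ds_comm 1 p] at hp
  omega

lemma ball_finite [Finite α] (R : ℤ) : {x : FreeGroup α | nm x ≤ R}.Finite := by
  have h := List.finite_length_le (α × Bool) R.toNat
  refine (h.preimage (f := FreeGroup.toWord) (FreeGroup.toWord_injective.injOn)).subset ?_
  intro x hx
  simp [nm, FreeGroup.norm] at hx ⊢
  omega

end Geometry
end Kap


namespace Kap

section Algebra
variable {α : Type*} [DecidableEq α]

/-- the word of a power of a generator -/
def zl (z : α) (m : ℤ) : List (α × Bool) := List.replicate m.natAbs (z, decide (0 ≤ m))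

lemma mk_zl (z : α) (m : ℤ) : FreeGroup.mk (zl z m) = FreeGroup.of z ^ m := by
  have h1 : ∀ n : ℕ, FreeGroup.mk (List.replicate n (z, true)) = FreeGroup.of z ^ n := by
    intro n
    induction n with
    | zero => rfl
    | succ n ih => rw [List.replicate_succ, mk_cons, ih, pow_succ']; rfl
  have h2 : ∀ n : ℕ, FreeGroup.mk (List.replicate n (z, false)) = (FreeGroup.of z ^ n)⁻¹ := by
    intro n
    induction n with
    | zero => rfl
    | succ n ih => rw [List.replicate_succ, mk_cons, ih, pow_succ, mul_inv_rev]; rfl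
  unfold zl
  rcases le_or_gt 0 m with h | h
  · simp only [h, decide_true, h1]
    rw [← zpow_natCast]; congr 1; omega
  · have : ¬ (0 ≤ m) := by omega
    simp only [this, decide_false, h2]
    rw [← zpow_natCast, ← zpow_neg]; congr 1; omega

lemma isReduced_zl (z : α) (m : ℤ) : FreeGroup.IsReduced (zl z m) := by
  unfold zl FreeGroup.IsReduced
  exact List.isChain_replicate_of_rel _ (by simp)

lemma length_zl (z : α) (m : ℤ) : ((zl z m).length : ℤ) = |m| := by
  simp [zl]

lemma mem_zl {z : α} {m : ℤ} {x : α × Bool} (h : x ∈ zl z m) : x.1 = z := by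
  unfold zl at h
  rw [List.eq_of_mem_replicate h]

lemma nm_mk {L : List (α × Bool)} (h : FreeGroup.IsReduced L) : nm (FreeGroup.mk L) = L.length := by
  rw [nm, norm_mk_of_reduced h]

lemma nm_zpow (z : α) (m : ℤ) : nm (FreeGroup.of z ^ m) = |m| := by
  rw [← mk_zl, nm_mk (isReduced_zl z m), length_zl]

lemma reduced_zl_append {z : α} {m : ℤ} {L : List (α × Bool)} (hL : FreeGroup.IsReduced L)
    (hh : ∀ x ∈ L.head?, x.1 ≠ z) : FreeGroup.IsReduced (zl z m ++ L) := by
  refine List.isChain_append.2 ⟨isReduced_zl z m, hL, ?_⟩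
  intro x hx y hy h
  exact absurd (h.symm.trans (mem_zl (List.mem_of_mem_getLast? hx))) (hh y hy)

lemma reduced_append_zl {z : α} {m : ℤ} {L : List (α × Bool)} (hL : FreeGroup.IsReduced L)
    (hh : ∀ x ∈ L.getLast?, x.1 ≠ z) : FreeGroup.IsReduced (L ++ zl z m) := by
  refine List.isChain_append.2 ⟨hL, isReduced_zl z m, ?_⟩
  intro x hx y hy h
  exact absurd (h.trans (mem_zl (List.mem_of_mem_head? hy))) (hh x hx)

/-- `f` does not start with a power of `z` -/
def NZ (z : α) (f : FreeGroup α) : Prop := ∀ m : ℤ, nm (FreeGroup.of z ^ m * f) = |m| + nm f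

lemma NZ_mk {z : α} {L : List (α × Bool)} (hL : FreeGroup.IsReduced L)
    (hh : ∀ x ∈ L.head?, x.1 ≠ z) : NZ z (FreeGroup.mk L) := by
  intro m
  rw [← mk_zl, FreeGroup.mul_mk, nm_mk (reduced_zl_append hL hh), nm_mk hL, ← length_zl z m]
  simp

lemma exists_NZ (z : α) (f : FreeGroup α) : ∃ (k : ℤ) (g : FreeGroup α),
    f = FreeGroup.of z ^ k * g ∧ NZ z g := by
  have key : ∀ L : List (α × Bool), FreeGroup.IsReduced L → ∃ (k : ℤ) (g : FreeGroup α),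
    FreeGroup.mk L = FreeGroup.of z ^ k * g ∧ NZ z g := by
    intro L
    induction L with
    | nil => intro _; exact ⟨0, 1, by simp; rfl, NZ_mk (L := []) FreeGroup.IsReduced.nil (by simp)⟩
    | cons c L ih =>
      intro h
      by_cases hc : c.1 = z
      · obtain ⟨k, g, h1, h2⟩ := ih (List.IsChain.tail h)
        rcases c with ⟨c, b⟩
        simp only at hc
        subst hc
        cases b
        · refine ⟨-1 + k, g, ?_, h2⟩
          rw [mk_cons, h1, zpow_add, zpow_neg_one, mul_assoc]; rfl
        · refine ⟨1 + k, g, ?_, h2⟩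
          rw [mk_cons, h1, zpow_add, zpow_one, mul_assoc]; rfl
      · exact ⟨0, _, by simp, NZ_mk h (by simpa using hc)⟩
  have := key f.toWord FreeGroup.isReduced_toWord
  rwa [FreeGroup.mk_toWord] at this

lemma NZ.ds {z : α} {f : FreeGroup α} (h : NZ z f) (m : ℤ) :
    ds (FreeGroup.of z ^ m) f = |m| + nm f := by
  have := h (-m)
  rw [Kap.ds, ← zpow_neg, this, abs_neg]

lemma centr {z : α} {s : FreeGroup α} {m m' : ℤ} (hm : m ≠ 0)
    (h : s * FreeGroup.of z ^ m * s⁻¹ = FreeGroup.of z ^ m') : ∃ k : ℤ, s = FreeGroup.of z ^ k := by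
  obtain ⟨k, f, rfl, hf⟩ := exists_NZ z s
  set Z := FreeGroup.of z with hZ
  have h1 : f * Z ^ m * f⁻¹ = Z ^ m' := by
    have : f * Z ^ m * f⁻¹ = Z ^ (-k) * ((Z ^ k * f) * Z ^ m * (Z ^ k * f)⁻¹) * Z ^ k := by
      group
    rw [this, h, ← zpow_add, ← zpow_add]; congr 1; ring
  have hm' : m' ≠ 0 := by
    rintro rfl
    rw [zpow_zero] at h1
    have h2 : Z ^ m = 1 := by
      have : Z ^ m = f⁻¹ * (f * Z ^ m * f⁻¹) * f := by group
      rw [this, h1]; group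
    have h3 := nm_zpow z m
    rw [← hZ, h2, nm_one] at h3
    exact hm (by simpa using h3.symm)
  have h2 : ∀ n : ℤ, f * Z ^ (m * n) = Z ^ (m' * n) * f := by
    intro n
    rw [zpow_mul, zpow_mul, ← h1, conj_zpow]; group
  have h3 : ∀ n : ℤ, n ≠ 0 → |m * n| = |m' * n| + 2 * nm f := by
    intro n hn
    have e1 : ds f (Z ^ (m' * n) * f) = |m * n| := by
      rw [← h2, ds_mul_right, nm_zpow]
    have e2 : ds (Z ^ (m' * n)) (Z ^ (m' * n) * f) = nm f := ds_mul_right _ _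
    have e3 := hf.ds (m' * n)
    have e4 := hf (m' * n)
    have hpos : 0 < |m' * n| := abs_pos.2 (mul_ne_zero hm' hn)
    have t1 := ds_tri f (Z ^ (m' * n)) (Z ^ (m' * n) * f)
    have f1 := four f (Z ^ (m' * n)) (Z ^ (m' * n) * f) 1
    rw [ds_one_right, ds_one_right, ds_one_right, nm_zpow, ds_comm f (Z ^ (m' * n)), e3, e4, e2, e1] at f1
    rw [ds_comm f (Z ^ (m' * n)), e3, e2, e1] at t1
    omega
  have h4 := h3 1 (by omega)
  have h5 := h3 2 (by omega)
  rw [mul_one, mul_one] at h4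
  rw [abs_mul, abs_mul] at h5
  have h6 : nm f = 0 := by simp at h5; omega
  exact ⟨k, by rw [nm_eq_zero.1 h6, mul_one]⟩

lemma auto_z {z : α} (a : MulAut (FreeGroup α)) {m m' : ℤ} (hm : m ≠ 0)
    (h : a (FreeGroup.of z) ^ m = FreeGroup.of z ^ m') :
    ∃ e : ℤ, (e = 1 ∨ e = -1) ∧ a (FreeGroup.of z) = FreeGroup.of z ^ e := by
  set Z := FreeGroup.of z with hZ
  have hZ1 : Z ≠ 1 := FreeGroup.of_ne_one z
  have hm' : m' ≠ 0 := by
    rintro rfl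
    rw [zpow_zero, ← map_zpow] at h
    have h2 : Z ^ m = 1 := by simpa using h
    have h3 := nm_zpow z m
    rw [← hZ, h2, nm_one] at h3
    exact hm (by simpa using h3.symm)
  obtain ⟨t, ht⟩ := centr (z := z) (s := a Z) hm' (m' := m') (by rw [← hZ, ← h]; group)
  refine ⟨t, ?_, ht⟩
  have h1 : Z = (a⁻¹ Z) ^ t := by
    rw [← map_zpow, ← hZ] at *
    rw [← ht, MulAut.inv_apply_self]
  set χ : FreeGroup α →* Multiplicative ℤ :=
    FreeGroup.lift (fun i => if i = z then Multiplicative.ofAdd 1 else 1) with hχ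
  have h2 : χ Z = Multiplicative.ofAdd 1 := by simp [hχ, hZ]
  have h3 : Multiplicative.toAdd (χ Z) = t * Multiplicative.toAdd (χ (a⁻¹ Z)) := by
    conv_lhs => rw [h1, map_zpow]
    simp
  rw [h2] at h3
  have h4 : t ∣ 1 := ⟨_, h3⟩
  exact Int.isUnit_iff.1 (isUnit_of_dvd_one h4)

lemma of_comm_one {z b : α} (hzb : z ≠ b) {c : FreeGroup α}
    (h1 : c * FreeGroup.of z * c⁻¹ = FreeGroup.of z) (h2 : c * FreeGroup.of b * c⁻¹ = FreeGroup.of b) :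
    c = 1 := by
  obtain ⟨k, rfl⟩ := centr (z := z) (s := c) (m := 1) (m' := 1) (by omega) (by simpa using h1)
  by_cases hk : k = 0
  · simp [hk]
  · obtain ⟨j, hj⟩ := centr (z := z) (s := FreeGroup.of b) (m := k) (m' := k) hk (by
      rw [mul_inv_eq_iff_eq_mul]; rw [mul_inv_eq_iff_eq_mul] at h2; exact h2.symm)
    have h3 : NZ z (FreeGroup.of b) := NZ_mk (L := [(b, true)]) FreeGroup.IsReduced.singleton
      (by simpa using hzb.symm)
    have h4 := h3 (-j)
    rw [hj, ← zpow_add] at h4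
    rw [nm_zpow, nm_zpow] at h4
    have h5 : nm (FreeGroup.of b) = 1 := by simp [nm]
    rw [hj, nm_zpow] at h5
    rw [abs_neg] at h4; simp at h4; omega

lemma conj_inj {z b : α} (hzb : z ≠ b) {c : FreeGroup α} (h : MulAut.conj c = 1) : c = 1 := by
  apply of_comm_one hzb
  · have := congrArg (fun f : MulAut (FreeGroup α) => f (FreeGroup.of z)) h
    simpa using this
  · have := congrArg (fun f : MulAut (FreeGroup α) => f (FreeGroup.of b)) h
    simpa using this

/-- the fixed subgroup -/
def fixS (a : MulAut (FreeGroup α)) : Subgroup (FreeGroup α) :=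
  a.toMonoidHom.eqLocus (MonoidHom.id _)

lemma mem_fixS {a : MulAut (FreeGroup α)} {x : FreeGroup α} : x ∈ fixS a ↔ a x = x := Iff.rfl

lemma fix_infinite (a : MulAut (FreeGroup α)) (ha : a ≠ 1) : ¬ (fixS a).FiniteIndex := by
  intro h
  apply ha
  ext x
  obtain ⟨n, hn, -, hx⟩ := Subgroup.exists_pow_mem_of_index_ne_zero h.index_ne_zero x
  rw [mem_fixS, map_pow] at hx
  exact pow_left_injective (by omega : n ≠ 0) hx

end Algebra

section Neumann

open scoped Pointwise

lemma avoid {G : Type*} [Group G] {ι : Type*} [Finite ι] (S : ι → Set G) (K : ι → Subgroup G)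
    (h : ∀ i, ∀ x ∈ S i, ∀ y ∈ S i, x⁻¹ * y ∈ K i) (hK : ∀ i, ¬ (K i).FiniteIndex) :
    ∃ d, ∀ i, d ∉ S i := by
  by_contra! hc
  cases nonempty_fintype ι
  classical
  let g : ι → G := fun i => if h : (S i).Nonempty then h.some else 1
  have hcov : ⋃ i ∈ (Finset.univ : Finset ι), g i • (K i : Set G) = Set.univ := by
    rw [Set.eq_univ_iff_forall]
    intro d
    obtain ⟨i, hi⟩ := hc d
    simp only [Set.mem_iUnion]
    refine ⟨i, Finset.mem_univ _, ?_⟩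
    have hne : (S i).Nonempty := ⟨d, hi⟩
    rw [mem_leftCoset_iff]
    have : g i = hne.some := by simp [g, hne]
    rw [this]
    exact h i _ hne.some_mem _ hi
  obtain ⟨k, -, hk⟩ := Subgroup.exists_finiteIndex_of_leftCoset_cover hcov
  exact hK k hk

lemma comap_infinite {G : Type*} [Group G] (K : Subgroup G) (a : MulAut G)
    (hK : ¬ K.FiniteIndex) : ¬ (K.comap a.toMonoidHom).FiniteIndex := by
  intro h
  apply hK
  constructor
  have := Subgroup.index_comap_of_surjective K (f := a.toMonoidHom) a.surjective
  rw [← this]; exact h.index_ne_zero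

lemma avoid2 {G : Type*} [Group G] {ι κ : Type*} [Finite ι] [Finite κ] (S : ι → Set G)
    (K : ι → Subgroup G) (y y' : κ → G)
    (h : ∀ i, ∀ x ∈ S i, ∀ y ∈ S i, x⁻¹ * y ∈ K i) (hK : ∀ i, ¬ (K i).FiniteIndex) :
    ∃ d, ∀ i k, y k * d * y' k ∉ S i := by
  obtain ⟨d, hd⟩ := avoid (ι := ι × κ) (fun p => {d | y p.2 * d * y' p.2 ∈ S p.1})
    (fun p => (K p.1).comap (MulAut.conj (y' p.2)⁻¹).toMonoidHom) (by
      rintro ⟨i, k⟩ x1 hx1 x2 hx2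
      have := h i _ hx1 _ hx2
      rw [Subgroup.mem_comap]
      convert this using 1
      simp [MulAut.conj_apply]
      group) (fun p => comap_infinite _ _ (hK _))
  exact ⟨d, fun i k => hd (i, k)⟩

lemma exists_D {α : Type*} [DecidableEq α] {z b : α} (hzb : z ≠ b) {ι : Type*} [Finite ι]
    (S : ι → Set (FreeGroup α)) (K : ι → Subgroup (FreeGroup α))
    (h : ∀ i, ∀ x ∈ S i, ∀ y ∈ S i, x⁻¹ * y ∈ K i) (hK : ∀ i, ¬ (K i).FiniteIndex) :
    ∃ D : List (α × Bool), FreeGroup.IsReduced D ∧ D.head? = some (b, true) ∧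
      D.getLast? = some (b, true) ∧ ∀ i, FreeGroup.mk D ∉ S i := by
  let y1 : Bool → List (α × Bool) := fun t => if t then [(b, true)] else [(b, true), (z, true)]
  let y2 : Bool → List (α × Bool) := fun t => if t then [(b, true)] else [(z, true), (b, true)]
  obtain ⟨d, hd⟩ := avoid2 (κ := Bool × Bool) S K (fun p => FreeGroup.mk (y1 p.1))
    (fun p => FreeGroup.mk (y2 p.2)) h hK
  set w := d.toWord with hw
  have hwr : FreeGroup.IsReduced w := FreeGroup.isReduced_toWord
  have hdw : d = FreeGroup.mk w := FreeGroup.mk_toWord.symm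
  let t1 : Bool := decide (w.head? = some (z, false))
  let t2 : Bool := decide (w.getLast? = some (z, false))
  have hbz : b ≠ z := hzb.symm
  have r1 : FreeGroup.IsReduced (y1 t1 ++ w) := by
    by_cases ht : w.head? = some (z, false)
    · have : t1 = true := by simp [t1, ht]
      rw [this]
      refine List.isChain_append.2 ⟨by simp [y1], hwr, ?_⟩
      intro x hx y hy
      rw [ht] at hy
      simp [y1] at hx hy
      subst hx; subst hy; simp [hbz]
    · have : t1 = false := by simp [t1, ht]
      rw [this]
      refine List.isChain_append.2 ⟨by simp [y1, hbz], hwr, ?_⟩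
      intro x hx y hy
      simp [y1] at hx
      subst hx
      intro h1
      rcases y with ⟨y, c⟩
      simp only at h1
      subst h1
      cases c
      · exact absurd hy ht
      · rfl
  have r2 : FreeGroup.IsReduced (y1 t1 ++ w ++ y2 t2) := by
    by_cases hw0 : w = []
    · have e1 : t1 = false := by simp [t1, hw0]
      have e2 : t2 = false := by simp [t2, hw0]
      rw [e1, e2, hw0]
      simp [y1, y2, FreeGroup.IsReduced, hbz, hzb]
    have hlast : ∀ x, x ∈ (y1 t1 ++ w).getLast? → x ∈ w.getLast? := by
      intro x hx
      rwa [List.getLast?_append_of_ne_nil _ hw0] at hx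
    by_cases ht : w.getLast? = some (z, false)
    · have : t2 = true := by simp [t2, ht]
      rw [this]
      refine List.isChain_append.2 ⟨r1, by simp [y2], ?_⟩
      intro x hx y hy
      have hx := hlast x hx
      rw [ht] at hx
      simp [y2] at hx hy
      subst hx; subst hy; simp [hzb]
    · have : t2 = false := by simp [t2, ht]
      rw [this]
      refine List.isChain_append.2 ⟨r1, by simp [y2, hzb], ?_⟩
      intro x hx y hy
      have hx2 := hlast x hx
      simp [y2] at hy
      subst hy
      intro h1
      rcases x with ⟨x, c⟩
      simp only at h1
      subst h1
      cases c
      · exact absurd hx2 ht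
      · rfl
  refine ⟨y1 t1 ++ w ++ y2 t2, r2, ?_, ?_, ?_⟩
  · cases t1 <;> simp [y1]
  · cases t2 <;> simp [y2]
  · intro i
    have := hd i (t1, t2)
    rw [hdw, FreeGroup.mul_mk, FreeGroup.mul_mk] at this
    exact this

end Neumann
end Kap


namespace Kap

section Reps
variable {α : Type*} [DecidableEq α]

lemma exists_reps {G : Type*} [Group G] (A : Subgroup (MulAut G))
    (hFin : ((MulAut.conj : G →* MulAut G).range.subgroupOf A).FiniteIndex) :
    ∃ S : Set (MulAut G), S.Finite ∧ ∀ a ∈ A, ∃ s ∈ S, ∃ g : G, a = MulAut.conj g * s := by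
  set I := ((MulAut.conj : G →* MulAut G).range.subgroupOf A) with hI
  have : Finite (A ⧸ I) := Subgroup.finite_quotient_of_finiteIndex
  refine ⟨Set.range (fun q : A ⧸ I => ((Quotient.out q : A) : MulAut G)), Set.finite_range _, ?_⟩
  intro a ha
  refine ⟨_, ⟨((⟨a, ha⟩ : A) : A ⧸ I), rfl⟩, ?_⟩
  have h1 : (((⟨a, ha⟩ : A) : A ⧸ I).out)⁻¹ * (⟨a, ha⟩ : A) ∈ I :=
    QuotientGroup.eq.1 (QuotientGroup.out_eq' _)
  set q := ((⟨a, ha⟩ : A) : A ⧸ I).out with hq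
  rw [hI, Subgroup.mem_subgroupOf] at h1
  obtain ⟨g, hg⟩ := h1
  refine ⟨(q : MulAut G) g, ?_⟩
  have h2 : a = (q : MulAut G) * MulAut.conj g := by
    rw [hg]; simp
  refine h2.trans ?_
  change (q : MulAut G) * MulAut.conj g = MulAut.conj ((q : MulAut G) g) * (q : MulAut G)
  ext x
  simp [MulAut.conj_apply]

lemma tor_finite {z b : α} (hzb : z ≠ b) (A : Subgroup (MulAut (FreeGroup α)))
    (hFin : ((MulAut.conj : FreeGroup α →* MulAut (FreeGroup α)).range.subgroupOf A).FiniteIndex) :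
    {a : MulAut (FreeGroup α) | a ∈ A ∧ a (FreeGroup.of z) = FreeGroup.of z ∧ IsOfFinOrder a}.Finite := by
  set I := ((MulAut.conj : FreeGroup α →* MulAut (FreeGroup α)).range.subgroupOf A) with hI
  have : Finite (A ⧸ I) := Subgroup.finite_quotient_of_finiteIndex
  set T := {a : MulAut (FreeGroup α) | a ∈ A ∧ a (FreeGroup.of z) = FreeGroup.of z ∧ IsOfFinOrder a}
  have : Finite T := by
    refine Finite.of_injective (fun t : T => ((⟨t.1, t.2.1⟩ : A) : A ⧸ I)) ?_
    rintro ⟨x, hxA, hxZ, hxo⟩ ⟨y, hyA, hyZ, hyo⟩ h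
    have h1 := QuotientGroup.eq.1 h
    rw [hI, Subgroup.mem_subgroupOf] at h1
    obtain ⟨c, hc⟩ := h1
    simp only [Subgroup.coe_mul, Subgroup.coe_inv] at hc
    have hy : y = x * MulAut.conj c := by rw [hc]; simp
    have hcZ : MulAut.conj c (FreeGroup.of z) = FreeGroup.of z := by
      rw [hc, MulAut.mul_apply, hyZ]
      nth_rewrite 1 [← hxZ]
      simp
    obtain ⟨k, hk⟩ := centr (z := z) (s := c) (m := 1) (m' := 1) (by omega) (by
      simpa using hcZ)
    have hcomm : Commute x (MulAut.conj c) := by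
      have hxc : x c = c := by rw [hk, map_zpow, hxZ]
      ext w
      simp [MulAut.conj_apply, hxc]
    have hfo : IsOfFinOrder (MulAut.conj c) := by
      rw [hc]
      refine Commute.isOfFinOrder_mul ?_ hxo.inv hyo
      rw [hy]
      exact (Commute.mul_right (Commute.refl x) hcomm).inv_left
    obtain ⟨n, hn, hn1⟩ := isOfFinOrder_iff_pow_eq_one.1 hfo
    rw [← map_pow] at hn1
    have h3 := conj_inj hzb hn1
    have h4 : c = 1 := pow_left_injective (by omega : n ≠ 0) (by simpa using h3)
    apply Subtype.ext
    simp [hy, h4]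
  exact Set.toFinite T

/-- all the genericity of the word `D` -/
lemma choose_D [Finite α] {z b : α} (hzb : z ≠ b) (A : Subgroup (MulAut (FreeGroup α)))
    (hFin : ((MulAut.conj : FreeGroup α →* MulAut (FreeGroup α)).range.subgroupOf A).FiniteIndex)
    (S : Set (MulAut (FreeGroup α))) (hS : S.Finite) {ι : Type*} [Finite ι]
    (Hl : ι → Subgroup (FreeGroup α)) (hinf : ∀ l, ¬ (Hl l).FiniteIndex) (R : ℤ) :
    ∃ D : List (α × Bool), FreeGroup.IsReduced D ∧ D.head? = some (b, true) ∧
      D.getLast? = some (b, true) ∧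
      (∀ s ∈ S, ∀ l, ∀ x y, nm x ≤ R → nm y ≤ R → x * s (FreeGroup.mk D) * y ∉ Hl l) ∧
      (∀ a ∈ A, a (FreeGroup.of z) = FreeGroup.of z → IsOfFinOrder a →
        a (FreeGroup.mk D) = FreeGroup.mk D → a = 1) := by
  have hT := tor_finite hzb A hFin
  set T := {a : MulAut (FreeGroup α) | a ∈ A ∧ a (FreeGroup.of z) = FreeGroup.of z ∧ IsOfFinOrder a}
    with hTdef
  have hB := ball_finite (α := α) R
  set B := {x : FreeGroup α | nm x ≤ R} with hBdef
  have : Finite S := hS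
  have : Finite B := hB
  have hT' : Finite {t : MulAut (FreeGroup α) // t ∈ T ∧ t ≠ 1} :=
    (hT.subset (fun t ht => ht.1) : {t | t ∈ T ∧ t ≠ 1}.Finite)
  obtain ⟨D, h1, h2, h3, h4⟩ := exists_D (z := z) (b := b) hzb
    (ι := (S × ι × B × B) ⊕ {t : MulAut (FreeGroup α) // t ∈ T ∧ t ≠ 1})
    (Sum.elim (fun p => {d | p.2.2.1.1 * p.1.1 d * p.2.2.2.1 ∈ Hl p.2.1})
      (fun t => (fixS t.1 : Set (FreeGroup α))))
    (Sum.elim (fun p => (Hl p.2.1).comap (MulAut.conj (p.2.2.2.1)⁻¹ * p.1.1).toMonoidHom)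
      (fun t => fixS t.1)) (by
      rintro (⟨s, l, x, y⟩ | t) d1 hd1 d2 hd2
      · simp only [Sum.elim_inl, Set.mem_ofPred_eq] at hd1 hd2 ⊢
        rw [Subgroup.mem_comap]
        have := (Hl l).mul_mem ((Hl l).inv_mem hd1) hd2
        convert this using 1
        simp
        group
      · exact (fixS t.1).mul_mem ((fixS t.1).inv_mem hd1) hd2) (by
      rintro (⟨s, l, x, y⟩ | t)
      · exact comap_infinite _ _ (hinf l)
      · exact fix_infinite _ t.2.2)
  refine ⟨D, h1, h2, h3, ?_, ?_⟩
  · intro s hs l x y hx hy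
    exact h4 (Sum.inl (⟨s, hs⟩, l, ⟨x, hx⟩, ⟨y, hy⟩))
  · intro a haA haZ hao had
    by_contra hne
    exact h4 (Sum.inr ⟨a, ⟨haA, haZ, hao⟩, hne⟩) had

lemma fix_final {z : α} (A : Subgroup (MulAut (FreeGroup α)))
    (hFin : ((MulAut.conj : FreeGroup α →* MulAut (FreeGroup α)).range.subgroupOf A).FiniteIndex)
    (d : FreeGroup α)
    (hd : ∀ p q : ℤ, nm (FreeGroup.of z ^ p * d * FreeGroup.of z ^ q) = |p| + nm d + |q|)
    (hG : ∀ a ∈ A, a (FreeGroup.of z) = FreeGroup.of z → IsOfFinOrder a → a d = d → a = 1)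
    (a : MulAut (FreeGroup α)) (haA : a ∈ A) (haZ : a (FreeGroup.of z) = FreeGroup.of z) (j : ℤ)
    (had : a d = FreeGroup.of z ^ j * d) : a = 1 := by
  obtain ⟨n, hn, -, hx⟩ := Subgroup.exists_pow_mem_of_index_ne_zero hFin.index_ne_zero (⟨a, haA⟩ : A)
  rw [Subgroup.mem_subgroupOf] at hx
  obtain ⟨c, hc⟩ := hx
  simp only [Subgroup.coe_pow] at hc
  have hpZ : ∀ n : ℕ, (a ^ n) (FreeGroup.of z) = FreeGroup.of z := by
    intro n
    induction n with
    | zero => simp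
    | succ n ih => rw [pow_succ, MulAut.mul_apply, haZ, ih]
  have hpd : ∀ n : ℕ, (a ^ n) d = FreeGroup.of z ^ (n * j) * d := by
    intro n
    induction n with
    | zero => simp
    | succ n ih =>
      rw [pow_succ, MulAut.mul_apply, had, map_mul, map_zpow, hpZ, ih, ← mul_assoc, ← zpow_add]
      congr 2; push_cast; ring
  have h1 := hpZ n
  have h2 := hpd n
  rw [← hc, MulAut.conj_apply] at h1 h2
  obtain ⟨k, hk⟩ := centr (z := z) (s := c) (m := 1) (m' := 1) (by omega) (by simpa using h1)
  rw [hk] at h2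
  have h3 : FreeGroup.of z ^ (k - n * j) * d * FreeGroup.of z ^ (-k) = d := by
    have : FreeGroup.of z ^ (k - n * j) * d * FreeGroup.of z ^ (-k)
      = FreeGroup.of z ^ (-(n * j)) * (FreeGroup.of z ^ k * d * (FreeGroup.of z ^ k)⁻¹) := by
      rw [show k - n * j = -(n*j) + k by ring, zpow_add, zpow_neg, zpow_neg]; group
    rw [this, h2, ← mul_assoc, ← zpow_add]; simp
  have h4 := hd (k - n * j) (-k)
  rw [h3] at h4
  have e1 := abs_nonneg (k - n * j)
  have e2 := abs_nonneg (-k)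
  have e3 : -k = 0 := abs_eq_zero.1 (by omega)
  have e4 : k - n * j = 0 := abs_eq_zero.1 (by omega)
  have e5 : k = 0 := by omega
  have e6 : (n : ℤ) * j = 0 := by omega
  have e7 : j = 0 := by
    rcases mul_eq_zero.1 e6 with h | h
    · omega
    · exact h
  apply hG a haA haZ
  · rw [isOfFinOrder_iff_pow_eq_one]
    refine ⟨n, hn, ?_⟩
    rw [← hc, hk, e5]; simp
  · rw [had, e7]; simp

/-- uniform constants -/
lemma unif_stab [Finite α] (S : Set (MulAut (FreeGroup α))) (hS : S.Finite) :
    ∃ lam C : ℤ, 1 ≤ lam ∧ 0 ≤ C ∧ ∀ a ∈ S, (∀ x, nm (a x) ≤ lam * nm x) ∧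
      (∀ x, nm x ≤ lam * nm (a x)) ∧
      ∀ p q x, ds p x + ds x q = ds p q →
        ds (a p) (a x) + ds (a x) (a q) ≤ ds (a p) (a q) + 2 * C := by
  induction S, hS using Set.Finite.induction_on with
  | empty => exact ⟨1, 0, le_rfl, le_rfl, by simp⟩
  | insert _ _ ih =>
    rename_i a s _ _
    obtain ⟨l1, C1, h1, h2, h3⟩ := ih
    obtain ⟨l2, C2, k1, k2, k3, k4, k5⟩ := stab a
    refine ⟨max l1 l2, max C1 C2, le_max_of_le_left h1, le_max_of_le_left h2, ?_⟩
    have hm : ∀ (x : FreeGroup α), l1 * nm x ≤ max l1 l2 * nm x := fun x =>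
      mul_le_mul_of_nonneg_right (le_max_left _ _) (nm_nonneg _)
    have hm2 : ∀ (x : FreeGroup α), l2 * nm x ≤ max l1 l2 * nm x := fun x =>
      mul_le_mul_of_nonneg_right (le_max_right _ _) (nm_nonneg _)
    have hC1 := le_max_left C1 C2
    have hC2 := le_max_right C1 C2
    intro a' ha'
    rcases Set.mem_insert_iff.1 ha' with rfl | ha'
    · refine ⟨fun x => (k3 x).trans (hm2 _), fun x => (k4 x).trans (hm2 _), ?_⟩
      intro p q x h
      have := k5 p q x h
      omega
    · obtain ⟨j3, j4, j5⟩ := h3 a' ha'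
      refine ⟨fun x => (j3 x).trans (hm _), fun x => (j4 x).trans (hm _), ?_⟩
      intro p q x h
      have := j5 p q x h
      omega

lemma unif_qconvex {n : ℕ} (Hl : Fin n → Subgroup (FreeGroup α)) (hfg : ∀ l, (Hl l).FG) :
    ∃ lam : ℤ, 0 ≤ lam ∧ ∀ l, ∀ h ∈ Hl l, ∀ (p : FreeGroup α) (C : ℤ),
      ds 1 p + ds p h ≤ ds 1 h + 2 * C → ∃ k ∈ Hl l, ds p k ≤ C + lam := by
  choose f hf hf2 using fun l => qconvex (Hl l) (hfg l)
  refine ⟨∑ l, f l, Finset.sum_nonneg (fun l _ => hf l), ?_⟩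
  intro l h hh p C hp
  obtain ⟨k, hk, hk2⟩ := hf2 l h hh p C hp
  have := Finset.single_le_sum (f := f) (fun l _ => hf l) (Finset.mem_univ l)
  exact ⟨k, hk, by omega⟩

end Reps
end Kap


namespace Kap

/-- `l` lies between `0` and `E` -/
def btw (l E : ℤ) : Prop := (0 ≤ l ∧ l ≤ E) ∨ (E ≤ l ∧ l ≤ 0)

/-- bookkeeping for the long powers of `z` along the geodesic from `1` to `f` -/
structure Runs {α : Type*} [DecidableEq α] (z : α) (f : FreeGroup α) (N : ℕ)
    (Y : ℕ → FreeGroup α) (E pos : ℕ → ℤ) (K M M' : ℤ) : Prop where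
  dist : ∀ n < N, ∀ n' < N, ∀ l l', btw l (E n) → btw l' (E n') →
    ds (Y n * FreeGroup.of z ^ l) (Y n' * FreeGroup.of z ^ l') = |pos n + |l| - (pos n' + |l'|)|
  d1 : ∀ n < N, ∀ l, btw l (E n) → nm (Y n * FreeGroup.of z ^ l) = pos n + |l| ∧
    ds (Y n * FreeGroup.of z ^ l) f = nm f - (pos n + |l|)
  nz1 : ∀ n < N, NZ z (Y n)⁻¹
  nz2 : ∀ n < N, NZ z ((Y n * FreeGroup.of z ^ (E n))⁻¹ * f)
  near : ∀ p C, ds 1 p + ds p f ≤ ds 1 f + 2 * C →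
    ∃ n < N, ∃ l, btw l (E n) ∧ ds p (Y n * FreeGroup.of z ^ l) ≤ C + K
  step : ∀ n, n + 1 < N → pos n + |E n| ≤ pos (n + 1)
  big : ∀ n < N, M ≤ |E n|
  small : ∀ n < N, |E n| ≤ M'

lemma cover (pos len : ℕ → ℕ) (N T G : ℕ) (hN : 0 < N) (h0 : pos 0 ≤ G)
    (hs : ∀ n, n + 1 < N → pos (n + 1) ≤ pos n + len n + G)
    (hT : T ≤ pos (N - 1) + len (N - 1) + G) (i : ℕ) (hi : i ≤ T) :
    ∃ n < N, ∃ k ≤ len n, i ≤ pos n + k + G ∧ pos n + k ≤ i + G := by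
  have key : ∀ n < N, ∀ i ≤ pos n + len n + G,
      ∃ n < N, ∃ k ≤ len n, i ≤ pos n + k + G ∧ pos n + k ≤ i + G := by
    intro n
    induction n with
    | zero =>
      intro h i hi
      by_cases h1 : i ≤ pos 0
      · exact ⟨0, h, 0, by omega, by omega, by omega⟩
      by_cases h2 : i ≤ pos 0 + len 0
      · exact ⟨0, h, i - pos 0, by omega, by omega, by omega⟩
      · exact ⟨0, h, len 0, by omega, by omega, by omega⟩
    | succ n ih =>
      intro h i hi
      by_cases h0 : i ≤ pos n + len n + G
      · exact ih (by omega) i h0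
      have := hs n h
      by_cases h2 : i ≤ pos (n+1) + len (n+1)
      · exact ⟨n+1, h, i - pos (n+1), by omega, by omega, by omega⟩
      · exact ⟨n+1, h, len (n+1), by omega, by omega, by omega⟩
  exact key (N - 1) (by omega) i (by omega)

section Blocks

/-- index of a letter -/
def idx (c : Fin 2 × Bool) : ℤ := 2 + 2 * (c.1 : ℕ) + (if c.2 then 1 else 0)
/-- sign -/
def sg (s : Bool) : ℤ := if s then 1 else -1
/-- size of exponents -/
def ab (c : Fin 2 × Bool) : ℕ → ℤ
  | 0 => idx c
  | 1 => 1
  | _ => idx (c.1, !c.2)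
/-- exponents -/
def ev (M : ℤ) (c : Fin 2 × Bool) (j : ℕ) : ℤ := sg c.2 * (M * ab c j)

lemma ab_pos (c : Fin 2 × Bool) (j : ℕ) : 1 ≤ ab c j ∧ ab c j ≤ 5 := by
  rcases c with ⟨t, s⟩
  rcases j with _ | _ | j <;> fin_cases t <;> cases s <;> simp [ab, idx]

lemma abs_ev {M : ℤ} (hM : 0 ≤ M) (c : Fin 2 × Bool) (j : ℕ) : |ev M c j| = M * ab c j := by
  have h := ab_pos c j
  unfold ev sg
  have : 0 ≤ M * ab c j := mul_nonneg hM (by omega)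
  split_ifs <;> simp [abs_of_nonneg this]

lemma ab_one {c : Fin 2 × Bool} {j : ℕ} (hj : j < 3) (h : ab c j = 1) : j = 1 := by
  rcases c with ⟨t, s⟩
  rcases j with _ | _ | j
  · revert h; fin_cases t <;> cases s <;> simp [ab, idx]
  · rfl
  · revert h; fin_cases t <;> cases s <;> simp [ab, idx]

lemma idx_inj {c c' : Fin 2 × Bool} (h : idx c = idx c') : c = c' := by
  rcases c with ⟨t, s⟩
  rcases c' with ⟨t', s'⟩
  revert h
  fin_cases t <;> fin_cases t' <;> cases s <;> cases s' <;> simp [idx]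

variable {α : Type*} (ι : Fin 2 → α) (D : List (α × Bool)) (M : ℤ)

/-- `D` or its inverse -/
def Dc (s : Bool) : List (α × Bool) := if s then D else FreeGroup.invRev D

/-- part of a block before the run -/
def Pc (c : Fin 2 × Bool) : ℕ → List (α × Bool)
  | 0 => [(ι c.1, c.2)] ++ Dc D c.2
  | j + 1 => Pc c j ++ zl (ι 0) (ev M c j) ++ Dc D c.2

/-- part of a block after the run -/
def Qc (c : Fin 2 × Bool) : ℕ → List (α × Bool)
  | 0 => Dc D c.2 ++ (zl (ι 0) (ev M c 1) ++ (Dc D c.2 ++ (zl (ι 0) (ev M c 2) ++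
      (Dc D c.2 ++ [(ι c.1, c.2)]))))
  | 1 => Dc D c.2 ++ (zl (ι 0) (ev M c 2) ++ (Dc D c.2 ++ [(ι c.1, c.2)]))
  | _ => Dc D c.2 ++ [(ι c.1, c.2)]

/-- a block -/
def Bk (c : Fin 2 × Bool) : List (α × Bool) := Pc ι D M c 0 ++ (zl (ι 0) (ev M c 0) ++ Qc ι D M c 0)

/-- the word of blocks -/
def Bw (W : List (Fin 2 × Bool)) : List (α × Bool) := W.flatMap (Bk ι D M)

/-- the hom -/
def rho : FreeGroup (Fin 2) →* FreeGroup α :=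
  FreeGroup.lift (fun t => FreeGroup.mk (Bk ι D M (t, true)))

lemma Bk_eq (c : Fin 2 × Bool) (j : ℕ) (hj : j < 3) :
    Bk ι D M c = Pc ι D M c j ++ (zl (ι 0) (ev M c j) ++ Qc ι D M c j) := by
  interval_cases j <;> simp [Bk, Pc, Qc]

lemma mk_append (A B : List (α × Bool)) :
    FreeGroup.mk (A ++ B) = FreeGroup.mk A * FreeGroup.mk B := FreeGroup.mul_mk.symm

lemma Dc_length (s : Bool) : (Dc D s).length = D.length := by
  cases s <;> simp [Dc]

lemma mk_Dc_false : FreeGroup.mk (Dc D false) = (FreeGroup.mk D)⁻¹ := by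
  simp [Dc, FreeGroup.inv_mk]

lemma Bw_append (W1 W2 : List (Fin 2 × Bool)) :
    Bw ι D M (W1 ++ W2) = Bw ι D M W1 ++ Bw ι D M W2 := by simp [Bw]

lemma Bw_cons (c : Fin 2 × Bool) (W2 : List (Fin 2 × Bool)) :
    Bw ι D M (c :: W2) = Bk ι D M c ++ Bw ι D M W2 := by simp [Bw]

lemma le_Bw (W : List (Fin 2 × Bool)) : W.length ≤ (Bw ι D M W).length := by
  induction W with
  | nil => simp
  | cons c W ih =>
    rw [Bw_cons]
    simp [Bk, Pc]
    omega

lemma Bk_big (c : Fin 2 × Bool) : 2 ≤ (Bk ι D M c).length := by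
  simp [Bk, Pc, Qc]; omega

variable [DecidableEq α]

lemma mk_Bk (c : Fin 2 × Bool) : FreeGroup.mk (Bk ι D M c) =
    FreeGroup.mk [(ι c.1, c.2)] * FreeGroup.mk (Dc D c.2) * FreeGroup.of (ι 0) ^ (ev M c 0) *
    FreeGroup.mk (Dc D c.2) * FreeGroup.of (ι 0) ^ (ev M c 1) *
    FreeGroup.mk (Dc D c.2) * FreeGroup.of (ι 0) ^ (ev M c 2) *
    FreeGroup.mk (Dc D c.2) * FreeGroup.mk [(ι c.1, c.2)] := by
  simp only [Bk, Pc, Qc, mk_append, mk_zl, mul_assoc]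

lemma mk_Bk_false (t : Fin 2) : FreeGroup.mk (Bk ι D M (t, false)) =
    (FreeGroup.mk (Bk ι D M (t, true)))⁻¹ := by
  have h1 : FreeGroup.mk [(ι t, false)] = (FreeGroup.mk [(ι t, true)])⁻¹ := by
    simp [FreeGroup.inv_mk, FreeGroup.invRev]
  have h2 : ev M (t, false) 0 = - ev M (t, true) 2 := by simp [ev, sg, ab]
  have h3 : ev M (t, false) 1 = - ev M (t, true) 1 := by simp [ev, sg, ab]
  have h4 : ev M (t, false) 2 = - ev M (t, true) 0 := by simp [ev, sg, ab]
  have h5 : Dc D true = D := rfl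
  rw [mk_Bk, mk_Bk, mk_Dc_false, h5, h1, h2, h3, h4]
  simp only [mul_inv_rev, zpow_neg, mul_assoc]

lemma rho_mk (W : List (Fin 2 × Bool)) : rho ι D M (FreeGroup.mk W) = FreeGroup.mk (Bw ι D M W) := by
  induction W with
  | nil => exact map_one _
  | cons c W ih =>
    rw [mk_cons, map_mul, ih, Bw_cons, mk_append]
    congr 1
    rcases c with ⟨t, s⟩
    cases s
    · rw [mk_Bk_false]; simp [rho]
    · simp [rho]

variable {ι D M}

variable (hι : Function.Injective ι) (hD : FreeGroup.IsReduced D) (hD1 : D.head? = some (ι 1, true))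
  (hD2 : D.getLast? = some (ι 1, true))

section
include hD hD1 hD2

lemma Dc_red (s : Bool) : FreeGroup.IsReduced (Dc D s) := by
  cases s
  · exact isReduced_invRev hD
  · exact hD

lemma Dc_head (s : Bool) : (Dc D s).head? = some (ι 1, s) := by
  cases s
  · simp [Dc, FreeGroup.invRev, hD2]
  · exact hD1

lemma Dc_last (s : Bool) : (Dc D s).getLast? = some (ι 1, s) := by
  cases s
  · simp [Dc, FreeGroup.invRev, hD1]
  · exact hD2

lemma Dc_ne (s : Bool) : Dc D s ≠ [] := by
  intro h
  have := Dc_head hD hD1 hD2 s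
  rw [h] at this
  simp at this

lemma Dc_app_head (s : Bool) (T : List (α × Bool)) : (Dc D s ++ T).head? = some (ι 1, s) := by
  rw [List.head?_append_of_ne_nil _ (Dc_ne hD hD1 hD2 s), Dc_head hD hD1 hD2]

lemma Dc_app_last (s : Bool) (T : List (α × Bool)) : (T ++ Dc D s).getLast? = some (ι 1, s) := by
  rw [List.getLast?_append_of_ne_nil _ (Dc_ne hD hD1 hD2 s), Dc_last hD hD1 hD2]

lemma redD {s : Bool} {T : List (α × Bool)} (hT : FreeGroup.IsReduced T)
    (hh : ∀ y ∈ T.head?, y.1 = ι 1 → y.2 = s) : FreeGroup.IsReduced (Dc D s ++ T) := by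
  refine List.isChain_append.2 ⟨Dc_red hD hD1 hD2 s, hT, ?_⟩
  intro x hx y hy h
  rw [Dc_last hD hD1 hD2] at hx
  simp at hx
  subst hx
  exact (hh y hy h.symm).symm

include hι

lemma ι01 : ι 1 ≠ ι 0 := fun h => by simpa using hι h

lemma redDz {s : Bool} {e : ℤ} {T : List (α × Bool)} (hT : FreeGroup.IsReduced (Dc D s ++ T)) :
    FreeGroup.IsReduced (Dc D s ++ (zl (ι 0) e ++ (Dc D s ++ T))) := by
  have h01 := ι01 hι hD hD1 hD2
  refine redD hD hD1 hD2 (reduced_zl_append hT ?_) ?_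
  · intro x hx
    rw [Dc_app_head hD hD1 hD2] at hx
    simp at hx
    subst hx
    exact h01
  · intro y hy h
    rw [List.head?_append, Dc_app_head hD hD1 hD2] at hy
    cases hz : (zl (ι 0) e).head? with
    | none => rw [hz] at hy; simp at hy; rw [← hy]
    | some w =>
      rw [hz] at hy; simp at hy
      subst hy
      exact absurd (h.symm.trans (mem_zl (List.mem_of_mem_head? hz))) h01

lemma Bk_red (c : Fin 2 × Bool) : FreeGroup.IsReduced (Bk ι D M c) := by
  have h01 := ι01 hι hD hD1 hD2
  have h1 : FreeGroup.IsReduced (Dc D c.2 ++ [(ι c.1, c.2)]) :=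
    redD hD hD1 hD2 FreeGroup.IsReduced.singleton (by simp)
  have h2 := redDz (e := ev M c 2) hι hD hD1 hD2 h1
  have h3 := redDz (e := ev M c 1) hι hD hD1 hD2 h2
  have h4 := redDz (e := ev M c 0) hι hD hD1 hD2 h3
  simp only [Bk, Pc, Qc, List.append_assoc]
  refine List.isChain_append.2 ⟨FreeGroup.IsReduced.singleton, h4, ?_⟩
  intro x hx y hy h
  rw [Dc_app_head hD hD1 hD2] at hy
  simp at hx hy
  subst hx; subst hy
  rfl

lemma Bw_red {W : List (Fin 2 × Bool)} (hW : FreeGroup.IsReduced W) :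
    FreeGroup.IsReduced (Bw ι D M W) := by
  have hne : ∀ c, Bk ι D M c ≠ [] := by
    intro c h; have := Bk_big ι D M c; simp [h] at this
  induction W with
  | nil => exact FreeGroup.IsReduced.nil
  | cons c W ih =>
    rw [Bw_cons]
    refine List.isChain_append.2 ⟨Bk_red hι hD hD1 hD2 c, ih (List.IsChain.tail hW), ?_⟩
    intro x hx y hy h
    cases W with
    | nil => simp [Bw] at hy
    | cons c' W =>
      rw [Bw_cons, List.head?_append_of_ne_nil _ (hne _)] at hy
      simp [Bk, Pc] at hy
      simp only [Bk, Qc, ← List.append_assoc] at hx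
      rw [List.getLast?_append_of_ne_nil _ (by simp)] at hx
      simp at hx
      subst hx; subst hy
      have := (List.isChain_cons_cons.1 hW).1
      exact this (hι h)

lemma nm_rho (w : FreeGroup (Fin 2)) : nm (rho ι D M w) = (Bw ι D M w.toWord).length := by
  conv_lhs => rw [← FreeGroup.mk_toWord (x := w)]
  rw [rho_mk, nm_mk (Bw_red hι hD hD1 hD2 FreeGroup.isReduced_toWord)]

lemma rho_inj : Function.Injective (rho ι D M) := by
  rw [injective_iff_map_eq_one]
  intro w hw
  have h := nm_rho (M := M) hι hD hD1 hD2 w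
  rw [hw, nm_one] at h
  have h2 := le_Bw ι D M w.toWord
  have h3 : w.toWord.length = 0 := by omega
  exact FreeGroup.toWord_eq_nil_iff.1 (List.length_eq_zero_iff.1 h3)

lemma rho_ne_top : (rho ι D M).range ≠ ⊤ := by
  intro h
  have h1 : FreeGroup.of (ι 0) ∈ (rho ι D M).range := by rw [h]; trivial
  obtain ⟨w, hw⟩ := h1
  have h2 := nm_rho (M := M) hι hD hD1 hD2 w
  rw [hw] at h2
  have h3 : nm (FreeGroup.of (ι 0)) = 1 := by simp [nm]
  rw [h3] at h2
  cases hx : w.toWord with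
  | nil => rw [hx] at h2; simp [Bw] at h2
  | cons c W =>
    rw [hx, Bw_cons, List.length_append] at h2
    have := Bk_big ι D M c
    omega

end

end Blocks
end Kap


namespace Kap

section RunsProof
variable {α : Type*} [DecidableEq α] (ι : Fin 2 → α) (D : List (α × Bool)) (M : ℤ)
  (W : List (Fin 2 × Bool))

/-- letter of the block containing run `n` -/
def bl (n : ℕ) : Fin 2 × Bool := W.getD (n / 3) (0, true)
/-- word before run `n` -/
def Aw (n : ℕ) : List (α × Bool) := Bw ι D M (W.take (n / 3)) ++ Pc ι D M (bl W n) (n % 3)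
/-- start of run `n` -/
def Yr (n : ℕ) : FreeGroup α := FreeGroup.mk (Aw ι D M W n)
/-- exponent of run `n` -/
def Er (n : ℕ) : ℤ := ev M (bl W n) (n % 3)
/-- position of run `n` -/
def pr (n : ℕ) : ℕ := (Aw ι D M W n).length

/-- word after run `n` -/
def Cw (n : ℕ) : List (α × Bool) := Qc ι D M (bl W n) (n % 3) ++ Bw ι D M (W.drop (n / 3 + 1))

variable {W}

lemma bl_eq {n : ℕ} (hn : n < 3 * W.length) : bl W n = W[n / 3]'(by omega) := by
  unfold bl
  rw [List.getD_eq_getElem]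

lemma split_run {n : ℕ} (hn : n < 3 * W.length) :
    Bw ι D M W = Aw ι D M W n ++ (zl (ι 0) (Er M W n) ++ Cw ι D M W n) := by
  have hk : n / 3 < W.length := by omega
  conv_lhs => rw [← List.take_append_drop (n / 3) W, List.drop_eq_getElem_cons hk, Bw_append, Bw_cons,
    ← bl_eq hn, Bk_eq ι D M (bl W n) (n % 3) (Nat.mod_lt _ (by omega))]
  simp [Aw, Er, Cw]

lemma take_zl (z : α) {l E : ℤ} (h : btw l E) : (zl z E).take l.natAbs = zl z l := by
  unfold zl
  rw [List.take_replicate]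
  rcases h with h | h
  · have h1 : 0 ≤ E := by omega
    have h2 : min l.natAbs E.natAbs = l.natAbs := by omega
    rw [h2]; simp [h1, h.1]
  · have h2 : min l.natAbs E.natAbs = l.natAbs := by omega
    rw [h2]
    by_cases h3 : l = 0
    · simp [h3]
    · have h4 : ¬ (0 ≤ l) := by omega
      have h5 : ¬ (0 ≤ E) := by omega
      simp [h4, h5]

lemma btw_natAbs {l E : ℤ} (h : btw l E) : l.natAbs ≤ E.natAbs := by
  rcases h with h | h <;> omega

lemma run_pt {n : ℕ} (hn : n < 3 * W.length) {l : ℤ} (hl : btw l (Er M W n)) :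
    Yr ι D M W n * FreeGroup.of (ι 0) ^ l =
      FreeGroup.mk ((Bw ι D M W).take (pr ι D M W n + l.natAbs)) ∧
    pr ι D M W n + l.natAbs ≤ (Bw ι D M W).length := by
  have h1 := split_run ι D M hn
  have hlen : (zl (ι 0) (Er M W n)).length = (Er M W n).natAbs := by simp [zl]
  have h2 := btw_natAbs hl
  constructor
  · rw [h1, pr, List.take_length_add_append, List.take_append_of_le_length (by omega),
      take_zl _ hl, mk_append, mk_zl]
    rfl
  · rw [h1]
    simp only [pr, List.length_append, hlen]
    omega

variable {ι D M}
variable (hι : Function.Injective ι) (hD : FreeGroup.IsReduced D) (hD1 : D.head? = some (ι 1, true))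
  (hD2 : D.getLast? = some (ι 1, true))

include hι hD hD1 hD2

lemma Pc_last (c : Fin 2 × Bool) (j : ℕ) (T : List (α × Bool)) :
    (T ++ Pc ι D M c j).getLast? = some (ι 1, c.2) := by
  cases j with
  | zero => rw [Pc, ← List.append_assoc, Dc_app_last hD hD1 hD2]
  | succ j => rw [Pc, ← List.append_assoc, Dc_app_last hD hD1 hD2]

lemma Qc_head (c : Fin 2 × Bool) (j : ℕ) (T : List (α × Bool)) :
    (Qc ι D M c j ++ T).head? = some (ι 1, c.2) := by
  rcases j with _ | _ | j <;> simp only [Qc, List.append_assoc] <;> rw [Dc_app_head hD hD1 hD2]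

lemma pr_step {n : ℕ} (hn : n + 1 < 3 * W.length) :
    pr ι D M W n + (Er M W n).natAbs ≤ pr ι D M W (n + 1) ∧
    pr ι D M W (n + 1) ≤ pr ι D M W n + (Er M W n).natAbs + (2 * D.length + 2) := by
  have hlen : (zl (ι 0) (Er M W n)).length = (Er M W n).natAbs := by simp [zl]
  by_cases h : n % 3 < 2
  · have h1 : (n + 1) / 3 = n / 3 := by omega
    have h2 : (n + 1) % 3 = n % 3 + 1 := by omega
    have h3 : bl W (n + 1) = bl W n := by unfold bl; rw [h1]
    have : Aw ι D M W (n + 1) = Aw ι D M W n ++ (zl (ι 0) (Er M W n) ++ Dc D (bl W n).2) := by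
      unfold Aw
      rw [h1, h2, h3, Pc]
      simp [Er]
    unfold pr
    rw [this]
    simp only [List.length_append, hlen, Dc_length]
    omega
  · have h0 : n % 3 = 2 := by omega
    have h1 : (n + 1) / 3 = n / 3 + 1 := by omega
    have h2 : (n + 1) % 3 = 0 := by omega
    have hk : n / 3 < W.length := by omega
    have hb : Bw ι D M [bl W n] = Bk ι D M (bl W n) := by simp [Bw]
    have : Aw ι D M W (n + 1) = Aw ι D M W n ++ (zl (ι 0) (Er M W n) ++ (Dc D (bl W n).2 ++
      ([(ι (bl W n).1, (bl W n).2)] ++ ([(ι (bl W (n+1)).1, (bl W (n+1)).2)] ++ Dc D (bl W (n+1)).2)))) := by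
      unfold Aw
      rw [h1, h2, Pc, List.take_succ_eq_append_getElem hk, Bw_append, ← bl_eq (by omega), hb,
        Bk_eq ι D M (bl W n) (n % 3) (by omega), h0]
      simp [Er, h0, Qc]
    unfold pr
    rw [this]
    simp only [List.length_append, hlen, Dc_length, List.length_singleton]
    omega

lemma runs (hM : 0 ≤ M) (hW : FreeGroup.IsReduced W) (hW0 : W ≠ []) :
    Runs (ι 0) (rho ι D M (FreeGroup.mk W)) (3 * W.length) (Yr ι D M W) (Er M W)
      (fun n => (pr ι D M W n : ℤ)) (2 * D.length + 3) M (5 * M) := by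
  have hL : FreeGroup.IsReduced (Bw ι D M W) := Bw_red hι hD hD1 hD2 hW
  set L := Bw ι D M W with hLd
  have hf : rho ι D M (FreeGroup.mk W) = FreeGroup.mk L := rho_mk ι D M W
  have hWl : 0 < W.length := List.length_pos_iff.2 hW0
  have h01 := ι01 hι hD hD1 hD2
  have hdist : ∀ i j : ℕ, i ≤ L.length → j ≤ L.length →
      ds (FreeGroup.mk (L.take i)) (FreeGroup.mk (L.take j)) = |(i : ℤ) - j| := by
    intro i j hi hj
    rcases le_total i j with h | h
    · rw [ds_take L hL i j h hj, abs_sub_comm, abs_of_nonneg (by omega)]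
    · rw [ds_comm, ds_take L hL j i h hi, abs_of_nonneg (by omega)]
  have h0 : FreeGroup.mk (L.take 0) = 1 := rfl
  have hend : FreeGroup.mk (L.take L.length) = FreeGroup.mk L := by simp
  have hnf : nm (FreeGroup.mk L) = L.length := nm_mk hL
  refine ⟨?_, ?_, ?_, ?_, ?_, ?_, ?_, ?_⟩
  · intro n hn n' hn' l l' hl hl'
    obtain ⟨e1, e2⟩ := run_pt ι D M hn hl
    obtain ⟨e3, e4⟩ := run_pt ι D M hn' hl'
    rw [e1, e3, hdist _ _ e2 e4]
    push_cast
    rfl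
  · intro n hn l hl
    obtain ⟨e1, e2⟩ := run_pt ι D M hn hl
    rw [hf, e1, hnf]
    rw [← hLd] at e2
    constructor
    · rw [← ds_one_left, ← h0, hdist _ _ (by omega) e2]
      push_cast
      rw [zero_sub, abs_neg, abs_of_nonneg (by positivity)]
    · rw [← hend, hdist _ _ e2 le_rfl, abs_sub_comm, abs_of_nonneg (by omega)]
      push_cast; rfl
  · intro n hn
    have h1 : FreeGroup.IsReduced (Aw ι D M W n) := by
      have := split_run ι D M hn
      rw [← hLd] at this
      rw [this] at hL
      exact (List.isChain_append.1 hL).1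
    rw [Yr, FreeGroup.inv_mk]
    refine NZ_mk (isReduced_invRev h1) ?_
    intro x hx
    have h2 := Pc_last hι hD hD1 hD2 (M := M) (bl W n) (n % 3) (Bw ι D M (W.take (n / 3)))
    change (Aw ι D M W n).getLast? = _ at h2
    simp [FreeGroup.invRev, h2] at hx
    rw [← hx]; exact h01
  · intro n hn
    have h3 := split_run ι D M hn
    rw [← hLd] at h3
    have h1 : FreeGroup.IsReduced (Cw ι D M W n) := by
      rw [h3] at hL
      exact (List.isChain_append.1 (List.isChain_append.1 hL).2.1).2.1
    have h4 : (Yr ι D M W n * FreeGroup.of (ι 0) ^ (Er M W n))⁻¹ * rho ι D M (FreeGroup.mk W) =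
        FreeGroup.mk (Cw ι D M W n) := by
      rw [hf, h3, mk_append, mk_append, mk_zl, Yr]; group
    rw [h4]
    refine NZ_mk h1 ?_
    intro x hx
    rw [Cw, Qc_head hι hD hD1 hD2] at hx
    simp at hx
    rw [← hx]; exact h01
  · intro p C hp
    obtain ⟨i, hi, h2⟩ := path_near (fun i => FreeGroup.mk (L.take i)) L.length 1 (by omega) (by
      intro i hi
      rw [hdist _ _ (by omega) (by omega)]
      push_cast
      simp) p
    simp only [h0, hend] at h2
    rw [hf] at hp
    have h3 : ds p (FreeGroup.mk (L.take i)) ≤ C + 1 := by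
      rw [ds_comm p 1] at h2
      omega
    obtain ⟨n, hn, k, hk, h4, h5⟩ := cover (pr ι D M W) (fun n => (Er M W n).natAbs) (3 * W.length)
      L.length (2 * D.length + 2) (by omega) (by
        simp [pr, Aw, Bw, Pc, Dc_length]; omega) (by
        intro n hn
        exact (pr_step hι hD hD1 hD2 hn).2) (by
        have hn : 3 * W.length - 1 < 3 * W.length := by omega
        have h5 := split_run ι D M hn
        have h6 : W.drop ((3 * W.length - 1) / 3 + 1) = [] := by
          rw [List.drop_eq_nil_iff]; omega
        have h7 : (3 * W.length - 1) % 3 = 2 := by omega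
        rw [← hLd] at h5
        rw [h5]
        simp only [pr, Cw, h6, h7, Qc, List.length_append, Dc_length, Bw, List.flatMap_nil,
          List.length_nil, List.length_singleton, zl, List.length_replicate]
        omega) i hi
    have : ∃ l : ℤ, btw l (Er M W n) ∧ l.natAbs = k := by
      rcases le_total 0 (Er M W n) with h | h
      · exact ⟨k, Or.inl ⟨by omega, by omega⟩, by omega⟩
      · exact ⟨-k, Or.inr ⟨by omega, by omega⟩, by omega⟩
    obtain ⟨l, hl, hlk⟩ := this
    refine ⟨n, hn, l, hl, ?_⟩
    obtain ⟨e1, e2⟩ := run_pt ι D M hn hl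
    have t := ds_tri p (FreeGroup.mk (L.take i)) (Yr ι D M W n * FreeGroup.of (ι 0) ^ l)
    rw [e1, hdist _ _ hi e2] at t
    rw [e1]
    have : |(i : ℤ) - ((pr ι D M W n + l.natAbs : ℕ) : ℤ)| ≤ 2 * D.length + 2 := by
      rw [abs_le]; omega
    rw [← hLd] at *
    omega
  · intro n hn
    have := (pr_step hι hD hD1 hD2 (M := M) hn).1
    rw [Int.abs_eq_natAbs]
    omega
  · intro n hn
    rw [Er, abs_ev hM]
    have := ab_pos (bl W n) (n % 3)
    nlinarith
  · intro n hn
    rw [Er, abs_ev hM]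
    have := ab_pos (bl W n) (n % 3)
    nlinarith

end RunsProof
end Kap


namespace Kap

section Geo
variable {α : Type*} [DecidableEq α]

/-- quasi-isometry constants for an automorphism -/
def Good (lam C : ℤ) (s : MulAut (FreeGroup α)) : Prop :=
  (∀ x, nm (s x) ≤ lam * nm x) ∧ (∀ x, nm x ≤ lam * nm (s x)) ∧
      ∀ p q x, ds p x + ds x q = ds p q →
        ds (s p) (s x) + ds (s x) (s q) ≤ ds (s p) (s q) + 2 * C

lemma shift {p p' q t : FreeGroup α} {C : ℤ} (h : ds p t + ds t q ≤ ds p q + 2 * C)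
    (hb : C + ds p p' < ds p t) : ds p' t + ds t q ≤ ds p' q + 2 * C := by
  have h1 := four p' t p q
  have h2 := ds_tri p p' t
  rw [ds_comm p' p, ds_comm t p] at h1
  omega

lemma le_of_lam {lam b n : ℤ} (hlam : 1 ≤ lam) (h : lam * b ≤ lam * n) : b ≤ n :=
  le_of_mul_le_mul_left h (by omega)

lemma mid {lam C b : ℤ} {s : MulAut (FreeGroup α)} (hlam : 1 ≤ lam) (hs : Good lam C s)
    {g f0 f' x : FreeGroup α} (hf : g * s f0 = f' * g) (hx : ds 1 x + ds x f0 = ds 1 f0)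
    (h1 : lam * b ≤ nm x) (h2 : lam * b ≤ ds x f0) (hb : C + nm g + 1 ≤ b) :
    ds 1 (g * s x) + ds (g * s x) f' ≤ ds 1 f' + 2 * C ∧ b - nm g ≤ nm (g * s x) ∧
      b - nm g ≤ ds (g * s x) f' := by
  obtain ⟨g1, g2, g3⟩ := hs
  have k1 : b ≤ ds g (g * s x) := by
    rw [ds_mul_right]
    exact le_of_lam hlam (h1.trans (g2 x))
  have k2 : b ≤ ds (g * s x) (f' * g) := by
    rw [← hf, ds_mul_left, ds, ← map_inv, ← map_mul]
    exact le_of_lam hlam (h2.trans (g2 _))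
  have k3 := g3 1 f0 x hx
  rw [map_one, ← ds_mul_left g 1, ← ds_mul_left g (s x), ← ds_mul_left g 1, hf, mul_one] at k3
  have e1 : ds g 1 = nm g := ds_one_right g
  have e2 : ds (f' * g) f' = nm g := by rw [ds_comm, ds_mul_right]
  have k4 := shift (p' := 1) k3 (by omega)
  have k5 := shift (p := f' * g) (p' := f') (q := 1) (t := g * s x) (C := C) (by
    rw [ds_comm (f' * g), ds_comm _ 1, ds_comm (f' * g) 1]; omega) (by
    rw [ds_comm (f' * g) (g * s x)]; omega)
  have t1 := ds_tri g 1 (g * s x)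
  have t2 := ds_tri (g * s x) f' (f' * g)
  rw [ds_comm f', ds_comm _ 1, ds_comm f' 1] at k5
  rw [ds_mul_right] at t2
  rw [ds_one_left (g * s x)] at *
  refine ⟨by omega, by omega, by omega⟩

variable {z : α}

lemma zpow_conj {s : MulAut (FreeGroup α)} {g' : FreeGroup α} {e : ℤ}
    (h : g' * s (FreeGroup.of z) * g'⁻¹ = FreeGroup.of z ^ e) (m : ℤ) :
    g' * s (FreeGroup.of z ^ m) = FreeGroup.of z ^ (e * m) * g' := by
  rw [zpow_mul, ← h, conj_zpow, map_zpow]; group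

lemma Dprime {lam C R : ℤ} {s : MulAut (FreeGroup α)} (hs : Good lam C s) {g' f f1 u : FreeGroup α}
    {e q : ℤ} (he : e = 1 ∨ e = -1) (hz : g' * s (FreeGroup.of z) * g'⁻¹ = FreeGroup.of z ^ e)
    (hq : g' = FreeGroup.of z ^ q * u) (hu : nm u ≤ R) (hf : NZ z f) (hf1 : NZ z f1)
    (hd : ds (g' * s f) f1 < nm f1) : |q| ≤ 2 * R + C := by
  set v := g' * s f with hv
  have hvd : ∀ k : ℤ, |k| + nm v ≤ ds v (FreeGroup.of z ^ k) := by
    intro k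
    have h1 := four f1 (FreeGroup.of z ^ k) v 1
    have hv0 := nm_nonneg v
    rw [ds_comm f1, hf1.ds, ds_one_right, ds_one_right, ds_one_right, nm_zpow, ds_comm f1 v,
      ds_comm _ v] at h1
    omega
  have hee : e * e = 1 := by rcases he with rfl | rfl <;> norm_num
  set m := - (e * q) with hm
  have hem : e * m = -q := by rw [hm]; linear_combination -q * hee
  have habs : |m| = |q| := by
    rw [hm, abs_neg, abs_mul]; rcases he with rfl | rfl <;> simp
  have hgeo : ds f 1 + ds 1 (FreeGroup.of z ^ m) = ds f (FreeGroup.of z ^ m) := by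
    rw [ds_one_right, ds_one_left, nm_zpow, ds_comm, hf.ds]; ring
  have h3 := hs.2.2 f (FreeGroup.of z ^ m) 1 hgeo
  rw [← ds_mul_left g' (s f), ← ds_mul_left g' (s 1), ← ds_mul_left g' (s f), ← hv, map_one, mul_one,
    zpow_conj hz, hem] at h3
  have e1 : FreeGroup.of z ^ (-q) * g' = u := by rw [hq]; group
  rw [e1] at h3
  have t1 := ds_tri v g' (FreeGroup.of z ^ q)
  have t2 := hvd q
  have e2 : ds g' (FreeGroup.of z ^ q) = nm u := by rw [ds_comm, hq, ds_mul_right]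
  have t3 := ds_tri (FreeGroup.of z ^ q) g' u
  have t4 := ds_tri (FreeGroup.of z ^ q) u 1
  rw [ds_comm _ g'] at t3
  rw [ds_one_right, ds_one_right, nm_zpow] at t4
  have t5 := ds_tri v 1 u
  rw [ds_one_right, ds_one_left] at t5
  omega

variable {f : FreeGroup α} {N : ℕ} {Y : ℕ → FreeGroup α} {E pos : ℕ → ℤ} {K M M' : ℤ}

lemma Runs.mono (h : Runs z f N Y E pos K M M') (n : ℕ) : ∀ n', n < n' → n' < N →
    pos n + |E n| ≤ pos n' := by
  intro n' hn
  induction n' with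
  | zero => omega
  | succ k ih =>
    intro hk
    have h1 := h.step k hk
    by_cases hnk : n = k
    · rw [hnk]; exact h1
    · have := ih (by omega) (by omega)
      have := abs_nonneg (E k)
      omega

lemma Runs.gap (h : Runs z f N Y E pos K M M') (n n' : ℕ) (hn : n + 1 < n') (hn' : n' < N) :
    pos n + |E n| + M ≤ pos n' := by
  have h1 := h.step n (by omega)
  have h2 := h.mono (n + 1) n' hn hn'
  have h3 := h.big (n + 1) (by omega)
  omega

lemma btw_abs {l E : ℤ} (h : btw l E) : |l| ≤ |E| := by
  rcases h with h | h
  · rw [abs_of_nonneg h.1, abs_of_nonneg (by omega)]; exact h.2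
  · rw [abs_of_nonpos h.2, abs_of_nonpos (by omega)]; omega

lemma btw_abs2 {l E : ℤ} (h : btw l E) : |l| + |E - l| = |E| := by
  rcases h with h | h
  · rw [abs_of_nonneg h.1, abs_of_nonneg (by omega : 0 ≤ E), abs_of_nonneg (by omega)]; omega
  · rw [abs_of_nonpos h.2, abs_of_nonpos (by omega : E ≤ 0), abs_of_nonpos (by omega)]; omega

lemma Runs.close (h : Runs z f N Y E pos K M M') {n n' : ℕ} (hn : n < N) (hn' : n' < N) {l l' : ℤ}
    (hl : btw l (E n)) (hl' : btw l' (E n'))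
    (hd : ds (Y n * FreeGroup.of z ^ l) (Y n' * FreeGroup.of z ^ l') < M) : n' ≤ n + 1 := by
  by_contra hc
  have h1 := h.gap n n' (by omega) hn'
  rw [h.dist n hn n' hn' l l' hl hl'] at hd
  have h2 := neg_le_abs (pos n + |l| - (pos n' + |l'|))
  have h3 := btw_abs hl
  have h4 := abs_nonneg l'
  omega

lemma FT {lam C : ℤ} {s : MulAut (FreeGroup α)} [Finite α] (hlam : 1 ≤ lam) (hs : Good lam C s)
    {g x : FreeGroup α} (h : Runs z f N Y E pos K M M') (eta : ℤ) (heta : eta = 1 ∨ eta = -1) (Wc : ℕ)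
    (hp : ∀ j : ℕ, j ≤ Wc → ds 1 (g * s (x * FreeGroup.of z ^ (eta * j))) +
      ds (g * s (x * FreeGroup.of z ^ (eta * j))) f ≤ ds 1 f + 2 * C)
    (hM : 2 * (C + K) + lam * Wc < M)
    (hcard : 3 * (ball_finite (α := α) (C + K)).toFinset.card < Wc + 1) :
    ∃ n < N, ∃ e : ℤ, (e = 1 ∨ e = -1) ∧ ∃ (q : ℤ) (u : FreeGroup α), nm u ≤ C + K ∧
      (Y n)⁻¹ * (g * s x) = FreeGroup.of z ^ q * u ∧
      ((Y n)⁻¹ * (g * s x)) * s (FreeGroup.of z) * ((Y n)⁻¹ * (g * s x))⁻¹ = FreeGroup.of z ^ e ∧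
      ∃ l, btw l (E n) ∧ ds (g * s x) (Y n * FreeGroup.of z ^ l) ≤ C + K + lam * Wc := by
  have hheta : |eta| = 1 := by rcases heta with rfl | rfl <;> simp
  have hnear : ∀ j : ℕ, ∃ n l, j ≤ Wc → n < N ∧ btw l (E n) ∧
      ds (g * s (x * FreeGroup.of z ^ (eta * j))) (Y n * FreeGroup.of z ^ l) ≤ C + K := by
    intro j
    by_cases hj : j ≤ Wc
    · obtain ⟨n, hn, l, hl, hd⟩ := h.near _ _ (hp j hj)
      exact ⟨n, l, fun _ => ⟨hn, hl, hd⟩⟩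
    · exact ⟨0, 0, fun hh => absurd hh hj⟩
  choose nn ll hnl using hnear
  have hPd : ∀ j j' : ℕ, j ≤ Wc → j' ≤ Wc → ds (g * s (x * FreeGroup.of z ^ (eta * j)))
      (g * s (x * FreeGroup.of z ^ (eta * j'))) ≤ lam * Wc := by
    intro j j' hj hj'
    have e1 : ds (g * s (x * FreeGroup.of z ^ (eta * j))) (g * s (x * FreeGroup.of z ^ (eta * j')))
        = nm (s (FreeGroup.of z ^ (eta * (j' - j : ℤ)))) := by
      rw [ds_mul_left, map_mul, map_mul, ds_mul_left, ds, ← map_inv, ← map_mul, ← zpow_neg, ← zpow_add]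
      congr 3; ring
    rw [e1]
    refine (hs.1 _).trans ?_
    rw [nm_zpow, abs_mul, hheta, one_mul]
    refine mul_le_mul_of_nonneg_left ?_ (by omega)
    rw [abs_le]; omega
  have hn0 : ∀ j ≤ Wc, nn j ≤ nn 0 + 1 ∧ nn 0 ≤ nn j + 1 := by
    intro j hj
    obtain ⟨a1, a2, a3⟩ := hnl j hj
    obtain ⟨b1, b2, b3⟩ := hnl 0 (by omega)
    have t1 := hPd j 0 hj (by omega)
    have t2 := ds_tri (Y (nn j) * FreeGroup.of z ^ (ll j)) (g * s (x * FreeGroup.of z ^ (eta * j)))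
      (Y (nn 0) * FreeGroup.of z ^ (ll 0))
    have t3 := ds_tri (g * s (x * FreeGroup.of z ^ (eta * j)))
      (g * s (x * FreeGroup.of z ^ (eta * (0 : ℕ)))) (Y (nn 0) * FreeGroup.of z ^ (ll 0))
    rw [ds_comm (Y (nn j) * FreeGroup.of z ^ (ll j)) (g * _)] at t2
    have hlt : ds (Y (nn j) * FreeGroup.of z ^ (ll j)) (Y (nn 0) * FreeGroup.of z ^ (ll 0)) < M := by
      linarith
    refine ⟨?_, h.close a1 b1 a2 b2 hlt⟩
    rw [ds_comm] at hlt
    exact h.close b1 a1 b2 a2 hlt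
  set T := (Finset.Icc (nn 0 - 1) (nn 0 + 1)) ×ˢ (ball_finite (α := α) (C + K)).toFinset with hT
  have hTc : T.card < (Finset.range (Wc + 1)).card := by
    rw [hT, Finset.card_product, Finset.card_range, Nat.card_Icc]
    refine lt_of_le_of_lt (Nat.mul_le_mul_right _ ?_) hcard
    omega
  obtain ⟨j, hj, j', hj', hne, heq⟩ := Finset.exists_ne_map_eq_of_card_lt_of_maps_to
    (f := fun j => (nn j, (Y (nn j) * FreeGroup.of z ^ (ll j))⁻¹ *
      (g * s (x * FreeGroup.of z ^ (eta * j))))) hTc (by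
    intro j hj
    have hj : j ≤ Wc := by simp at hj; omega
    have h1 := hn0 j hj
    simp only [hT, Finset.coe_product, Set.mem_prod, Finset.mem_coe, Finset.mem_Icc,
      Set.Finite.mem_toFinset]
    refine ⟨by omega, ?_⟩
    have := (hnl j hj).2.2
    rw [ds_comm] at this
    exact this)
  have hj : j ≤ Wc := by simp at hj; omega
  have hj' : j' ≤ Wc := by simp at hj'; omega
  simp only [Prod.mk.injEq] at heq
  obtain ⟨hnn, hu⟩ := heq
  rw [← hnn] at hu
  obtain ⟨a1, a2, a3⟩ := hnl j hj
  set n := nn j with hn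
  set u := (Y n * FreeGroup.of z ^ (ll j))⁻¹ * (g * s (x * FreeGroup.of z ^ (eta * j))) with hudef
  set g' := (Y n)⁻¹ * (g * s x) with hg'
  have k1 : g' * s (FreeGroup.of z) ^ (eta * j) = FreeGroup.of z ^ (ll j) * u := by
    rw [hudef, hg', map_mul, map_zpow]; group
  have k2 : g' * s (FreeGroup.of z) ^ (eta * j') = FreeGroup.of z ^ (ll j') * u := by
    rw [hu, hg', map_mul, map_zpow]; group
  have k3 : (MulAut.conj g' * s) (FreeGroup.of z) ^ (eta * j - eta * j') =
      FreeGroup.of z ^ (ll j - ll j') := by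
    have : (MulAut.conj g' * s) (FreeGroup.of z) ^ (eta * j - eta * j') =
      (g' * s (FreeGroup.of z) ^ (eta * j)) * (g' * s (FreeGroup.of z) ^ (eta * j'))⁻¹ := by
      rw [MulAut.mul_apply, MulAut.conj_apply, conj_zpow, zpow_sub]; group
    rw [this, k1, k2, zpow_sub]; group
  have k4 : eta * (j : ℤ) - eta * j' ≠ 0 := by
    rcases heta with rfl | rfl <;> omega
  obtain ⟨e, he, hez⟩ := auto_z (MulAut.conj g' * s) k4 k3
  rw [MulAut.mul_apply, MulAut.conj_apply] at hez
  refine ⟨n, a1, e, he, ll j - e * (eta * j), u, ?_, ?_, hez, ll j, a2, ?_⟩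
  · rw [ds_comm] at a3; exact a3
  · have := zpow_conj hez (eta * j)
    rw [map_zpow, k1] at this
    rw [sub_eq_neg_add, zpow_add, mul_assoc, this, zpow_neg, inv_mul_cancel_left]
  · have t1 := hPd 0 j (by omega) hj
    have t2 := ds_tri (g * s x) (g * s (x * FreeGroup.of z ^ (eta * j))) (Y n * FreeGroup.of z ^ (ll j))
    simp only [Nat.cast_zero, mul_zero, zpow_zero, mul_one] at t1
    linarith

lemma corr {lam C b : ℤ} {s : MulAut (FreeGroup α)} [Finite α] (hlam : 1 ≤ lam) (hs : Good lam C s)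
    {g f0 : FreeGroup α} {N0 : ℕ} {X : ℕ → FreeGroup α} {E0 pos0 : ℕ → ℤ}
    (h0 : Runs z f0 N0 X E0 pos0 K M M') (h : Runs z f N Y E pos K M M') (Wc : ℕ)
    (hf : g * s f0 = f * g)
    (hM : 2 * (C + K) + lam * Wc < M) (hMW : (Wc : ℤ) ≤ M)
    (hcard : 3 * (ball_finite (α := α) (C + K)).toFinset.card < Wc + 1)
    (hC : 0 ≤ C) (hK : 0 ≤ K)
    (hb : b = 2 * nm g + 2 * C + K + lam * Wc + M' + 1) (n0 : ℕ) (hn0 : n0 < N0)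
    (hpos : lam * b ≤ pos0 n0) (hpos2 : pos0 n0 + |E0 n0| + lam * b ≤ nm f0) :
    ∃ n < N, ∃ e : ℤ, (e = 1 ∨ e = -1) ∧ ∃ (q : ℤ) (u : FreeGroup α), nm u ≤ C + K ∧
      (Y n)⁻¹ * (g * s (X n0)) = FreeGroup.of z ^ q * u ∧
      ((Y n)⁻¹ * (g * s (X n0))) * s (FreeGroup.of z) * ((Y n)⁻¹ * (g * s (X n0)))⁻¹
        = FreeGroup.of z ^ e ∧
      |q| ≤ 2 * (C + K) + C ∧ |e * E0 n0 + q - E n| ≤ 2 * (C + K) + C := by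
  have hg := nm_nonneg g
  have hWl : 0 ≤ lam * (Wc : ℤ) := by positivity
  have hM'0 : 0 ≤ M' := (abs_nonneg _).trans (h0.small n0 hn0)
  have hbig := h0.big n0 hn0
  obtain ⟨eta, heta, hEe⟩ : ∃ eta : ℤ, (eta = 1 ∨ eta = -1) ∧ ∀ j : ℕ, j ≤ Wc →
      btw (eta * j) (E0 n0) := by
    rcases le_total 0 (E0 n0) with h1 | h1
    · rw [abs_of_nonneg h1] at hbig
      exact ⟨1, Or.inl rfl, fun j hj => Or.inl ⟨by omega, by omega⟩⟩
    · rw [abs_of_nonpos h1] at hbig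
      exact ⟨-1, Or.inr rfl, fun j hj => Or.inr ⟨by omega, by omega⟩⟩
  have hmid : ∀ j : ℕ, j ≤ Wc → ds 1 (g * s (X n0 * FreeGroup.of z ^ (eta * j))) +
      ds (g * s (X n0 * FreeGroup.of z ^ (eta * j))) f ≤ ds 1 f + 2 * C ∧
      b - nm g ≤ nm (g * s (X n0 * FreeGroup.of z ^ (eta * j))) ∧
      b - nm g ≤ ds (g * s (X n0 * FreeGroup.of z ^ (eta * j))) f := by
    intro j hj
    obtain ⟨d1, d2⟩ := h0.d1 n0 hn0 _ (hEe j hj)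
    have d3 := abs_nonneg (eta * (j : ℤ))
    have d4 := btw_abs (hEe j hj)
    refine mid hlam hs hf ?_ ?_ ?_ (by omega)
    · rw [ds_one_left, ds_one_left]; omega
    · omega
    · omega
  obtain ⟨n, hn, e, he, q, u, hu, hq, hz, l, hl, hd⟩ := FT hlam hs h eta heta Wc
    (fun j hj => (hmid j hj).1) hM hcard
  obtain ⟨-, m2, m3⟩ := hmid 0 (by omega)
  simp only [Nat.cast_zero, mul_zero, zpow_zero, mul_one] at m2 m3
  have hlb := btw_abs2 hl
  have hEs := h.small n hn
  have hl1 := abs_nonneg l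
  have hl2 := abs_nonneg (E n - l)
  refine ⟨n, hn, e, he, q, u, hu, hq, hz, ?_, ?_⟩
  · refine Dprime hs he hz hq hu (h0.nz1 n0 hn0) (h.nz1 n hn) ?_
    have e1 : (Y n)⁻¹ * (g * s (X n0)) * s (X n0)⁻¹ = (Y n)⁻¹ * g := by
      rw [map_inv]; group
    rw [e1, ds_comm, ds_mul_right, nm_inv]
    have t1 := ds_tri 1 (Y n * FreeGroup.of z ^ l) (g * s (X n0))
    have t2 := ds_tri 1 (Y n) (Y n * FreeGroup.of z ^ l)
    rw [ds_mul_right, nm_zpow, ds_one_left, ds_one_left] at t2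
    rw [ds_one_left, ds_one_left, ds_comm (Y n * _)] at t1
    omega
  · set g' := (Y n)⁻¹ * (g * s (X n0)) with hg'
    set g2 := FreeGroup.of z ^ (-(E n) + e * E0 n0) * g' with hg2
    have e0 : g2 = (Y n * FreeGroup.of z ^ (E n))⁻¹ * (g * s (X n0 * FreeGroup.of z ^ (E0 n0))) := by
      rw [hg2, zpow_add, mul_assoc, ← zpow_conj hz, map_mul, zpow_neg, hg']; group
    have e1 : g2 * s (FreeGroup.of z) * g2⁻¹ = FreeGroup.of z ^ e := by
      rw [hg2]
      have : FreeGroup.of z ^ (-(E n) + e * E0 n0) * g' * s (FreeGroup.of z) *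
        (FreeGroup.of z ^ (-(E n) + e * E0 n0) * g')⁻¹ = FreeGroup.of z ^ (-(E n) + e * E0 n0) *
          (g' * s (FreeGroup.of z) * g'⁻¹) * (FreeGroup.of z ^ (-(E n) + e * E0 n0))⁻¹ := by
        simp only [mul_inv_rev, mul_assoc]
      rw [this, hz, ← zpow_neg, ← zpow_add, ← zpow_add]
      congr 1; ring
    have e2 : g2 = FreeGroup.of z ^ (e * E0 n0 + q - E n) * u := by
      rw [hg2, hq, ← mul_assoc, ← zpow_add]
      congr 2; ring
    refine Dprime hs he e1 e2 hu (h0.nz2 n0 hn0) (h.nz2 n hn) ?_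
    have e3 : g2 * s ((X n0 * FreeGroup.of z ^ (E0 n0))⁻¹ * f0) =
        (Y n * FreeGroup.of z ^ (E n))⁻¹ * f * g := by
      rw [e0, mul_assoc _ f g, ← hf, map_mul s _ f0, map_inv s]; group
    rw [e3, ds_comm, ds_mul_right]
    change nm g < ds (Y n * FreeGroup.of z ^ (E n)) f
    have t1 := ds_tri (g * s (X n0)) (Y n * FreeGroup.of z ^ l) f
    have t2 := ds_tri (Y n * FreeGroup.of z ^ l) (Y n * FreeGroup.of z ^ (E n)) f
    have t3 : ds (Y n * FreeGroup.of z ^ l) (Y n * FreeGroup.of z ^ (E n)) = |E n - l| := by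
      rw [ds_mul_left, ds, ← zpow_neg, ← zpow_add, nm_zpow]; congr 1; ring
    omega

end Geo
end Kap


namespace Kap

section Claims

lemma exists_pow_big {β : Type*} [DecidableEq β] [Finite β] {w : FreeGroup β} (hw : w ≠ 1) (k : ℕ) :
    ∃ n : ℕ, k ≤ (w ^ n).toWord.length := by
  by_contra! hc
  have hinj : Function.Injective (fun n : ℕ => w ^ n) := by
    rw [injective_pow_iff_not_isOfFinOrder]
    intro h
    obtain ⟨n, hn, hn1⟩ := isOfFinOrder_iff_pow_eq_one.1 h
    exact hw (pow_left_injective (by omega : n ≠ 0) (by simpa using hn1))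
  refine Set.infinite_range_of_injective hinj ((ball_finite (α := β) k).subset ?_)
  rintro _ ⟨n, rfl⟩
  have := hc n
  change nm (w ^ n) ≤ k
  unfold nm FreeGroup.norm
  omega

variable {α : Type*} [DecidableEq α] {ι : Fin 2 → α} {D : List (α × Bool)} {M : ℤ}

lemma split_geo {A B : List (α × Bool)} (h : FreeGroup.IsReduced (A ++ B)) :
    ds 1 (FreeGroup.mk A) + ds (FreeGroup.mk A) (FreeGroup.mk (A ++ B)) = ds 1 (FreeGroup.mk (A ++ B)) ∧
    nm (FreeGroup.mk A) = A.length ∧ ds (FreeGroup.mk A) (FreeGroup.mk (A ++ B)) = B.length := by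
  obtain ⟨h1, h2, -⟩ := List.isChain_append.1 h
  rw [ds_one_left, ds_one_left, nm_mk h, nm_mk h1, mk_append, ds_mul_right, nm_mk h2]
  simp

variable (hι : Function.Injective ι) (hD : FreeGroup.IsReduced D) (hD1 : D.head? = some (ι 1, true))
  (hD2 : D.getLast? = some (ι 1, true))

include hι hD hD1 hD2

lemma claimN {lam C lamN : ℤ} {s : MulAut (FreeGroup α)} (hlam : 1 ≤ lam) (hs : Good lam C s)
    (H : Subgroup (FreeGroup α))
    (hH : ∀ h ∈ H, ∀ (p : FreeGroup α) (C : ℤ),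
      ds 1 p + ds p h ≤ ds 1 h + 2 * C → ∃ k ∈ H, ds p k ≤ C + lamN)
    (hG : ∀ x y, nm x ≤ C + lamN → nm y ≤ C + lamN → x * s (FreeGroup.mk D) * y ∉ H)
    (g : FreeGroup α) (w : FreeGroup (Fin 2)) (hw : w ≠ 1) :
    (MulAut.conj g * s) (rho ι D M w) ∉ H := by
  intro hmem
  set b := C + nm g + 1 with hb
  set k := (lam * b).toNat with hk
  have hkb : lam * b ≤ k := Int.self_le_toNat _
  obtain ⟨n, hn⟩ := exists_pow_big hw (2 * k + 1)
  set W := (w ^ n).toWord with hW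
  have hWr : FreeGroup.IsReduced W := FreeGroup.isReduced_toWord
  have hkW : k < W.length := by omega
  set W1 := W.take k with hW1
  set W2 := W.drop (k + 1) with hW2
  set c := W[k] with hc
  have hWs : W = W1 ++ c :: W2 := by
    rw [hW1, hW2, hc, ← List.drop_eq_getElem_cons hkW, List.take_append_drop]
  have l1 : W1.length = k := by simp [hW1]; omega
  have l2 : k ≤ W2.length := by simp [hW2]; omega
  have b1 := le_Bw ι D M W1
  have b2 := le_Bw ι D M W2
  have hf0 : rho ι D M w ^ n = FreeGroup.mk (Bw ι D M W) := by
    rw [← map_pow, ← rho_mk, hW, FreeGroup.mk_toWord]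
  have hL : FreeGroup.IsReduced (Bw ι D M W) := Bw_red hι hD hD1 hD2 hWr
  set f0 := FreeGroup.mk (Bw ι D M W) with hf0d
  set f' := g * s f0 * g⁻¹ with hf'
  have hf'H : f' ∈ H := by
    have := H.pow_mem hmem n
    rw [← map_pow, hf0] at this
    exact this
  have hfg : g * s f0 = f' * g := by rw [hf']; group
  set y := [(ι c.1, c.2)] with hy
  have dec1 : Bw ι D M W = (Bw ι D M W1 ++ y) ++ (Dc D c.2 ++ (zl (ι 0) (ev M c 0) ++
      (Qc ι D M c 0 ++ Bw ι D M W2))) := by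
    rw [hWs, Bw_append, Bw_cons]; simp [Bk, Pc, hy]
  have dec2 : Bw ι D M W = ((Bw ι D M W1 ++ y) ++ Dc D c.2) ++ (zl (ι 0) (ev M c 0) ++
      (Qc ι D M c 0 ++ Bw ι D M W2)) := by
    rw [hWs, Bw_append, Bw_cons]; simp [Bk, Pc, hy]
  have main : ∀ A B : List (α × Bool), Bw ι D M W = A ++ B → k ≤ A.length → k ≤ B.length →
      ∃ h ∈ H, ds (g * s (FreeGroup.mk A)) h ≤ C + lamN := by
    intro A B hAB hA hB
    rw [hAB] at hL
    obtain ⟨e1, e2, e3⟩ := split_geo hL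
    rw [← hAB, ← hf0d] at e1 e3
    obtain ⟨m1, -, -⟩ := mid (b := b) hlam hs hfg e1 (by rw [e2]; omega) (by rw [e3]; omega) (by omega)
    exact hH f' hf'H _ _ m1
  obtain ⟨h1, h1H, d1⟩ := main _ _ dec1 (by simp; omega) (by simp; omega)
  obtain ⟨h2, h2H, d2⟩ := main _ _ dec2 (by simp; omega) (by simp; omega)
  set x := FreeGroup.mk (Bw ι D M W1 ++ y) with hx
  rw [mk_append, ← hx, map_mul] at d2
  rw [ds_comm] at d1
  have d1' : nm (h1⁻¹ * (g * s x)) ≤ C + lamN := d1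
  have d2' : nm ((g * (s x * s (FreeGroup.mk (Dc D c.2))))⁻¹ * h2) ≤ C + lamN := d2
  have hm : h1⁻¹ * h2 ∈ H := H.mul_mem (H.inv_mem h1H) h2H
  cases hcs : c.2 with
  | true =>
    rw [hcs] at d2'
    refine hG _ _ d1' d2' ?_
    convert hm using 1
    simp only [Dc]
    simp
    group
  | false =>
    rw [hcs, mk_Dc_false] at d2'
    rw [← nm_inv] at d1' d2'
    refine hG _ _ d2' d1' ?_
    convert H.inv_mem hm using 1
    rw [map_inv]
    group

lemma deep {W : List (Fin 2 × Bool)} (hW : FreeGroup.IsReduced W) {n k : ℕ} (hk : k ≤ n / 3)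
    (hk2 : n / 3 + 1 + k ≤ W.length) : (k : ℤ) ≤ pr ι D M W n ∧
    (pr ι D M W n : ℤ) + |Er M W n| + k ≤ nm (rho ι D M (FreeGroup.mk W)) := by
  have hn : n < 3 * W.length := by omega
  constructor
  · have b1 := le_Bw ι D M (W.take (n / 3))
    rw [List.length_take] at b1
    unfold pr Aw
    rw [List.length_append]
    omega
  · rw [rho_mk, nm_mk (Bw_red hι hD hD1 hD2 hW), split_run ι D M hn, List.length_append,
      List.length_append, Cw, List.length_append]
    have b2 := le_Bw ι D M (W.drop (n / 3 + 1))
    rw [List.length_drop] at b2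
    have h3 := length_zl (ι 0) (Er M W n)
    unfold pr
    push_cast
    omega

lemma nm_zdz (s : Bool) (p q : ℤ) : nm (FreeGroup.of (ι 0) ^ p * FreeGroup.mk (Dc D s) *
    FreeGroup.of (ι 0) ^ q) = |p| + nm (FreeGroup.mk (Dc D s)) + |q| := by
  have h01 := ι01 hι hD hD1 hD2
  have h1 : FreeGroup.IsReduced (Dc D s ++ zl (ι 0) q) := by
    refine reduced_append_zl (Dc_red hD hD1 hD2 s) ?_
    intro x hx
    rw [Dc_last hD hD1 hD2] at hx
    simp at hx
    rw [← hx]; exact h01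
  have h2 : FreeGroup.IsReduced (zl (ι 0) p ++ (Dc D s ++ zl (ι 0) q)) := by
    refine reduced_zl_append h1 ?_
    intro x hx
    rw [Dc_app_head hD hD1 hD2] at hx
    simp at hx
    rw [← hx]; exact h01
  rw [← mk_zl, ← mk_zl, mul_assoc, ← mk_append, ← mk_append, nm_mk h2, nm_mk (Dc_red hD hD1 hD2 s),
    ← length_zl (ι 0) p, ← length_zl (ι 0) q]
  push_cast [List.length_append]
  ring

lemma Yr_one {W : List (Fin 2 × Bool)} {n : ℕ} (hn : n % 3 = 0) : Yr ι D M W (n + 1) =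
    Yr ι D M W n * FreeGroup.of (ι 0) ^ (Er M W n) * FreeGroup.mk (Dc D (bl W n).2) := by
  have h1 : (n + 1) / 3 = n / 3 := by omega
  have h2 : (n + 1) % 3 = 0 + 1 := by omega
  have h3 : bl W (n + 1) = bl W n := by unfold bl; rw [h1]
  unfold Yr Aw Er
  rw [h1, h2, h3, Pc, hn, mk_append, mk_append, mk_append, mk_append, mk_zl]
  group

end Claims
end Kap


namespace Kap

section Final

lemma abs_ab {M K1 e E0 q E i j : ℤ} (hM : 2 * K1 < M) (he : e = 1 ∨ e = -1)
    (h1 : |q| ≤ K1) (h2 : |e * E0 + q - E| ≤ K1) (hE0 : |E0| = M * i) (hE : |E| = M * j) :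
    i = j := by
  have hq := abs_le.1 h1
  have h3 : abs (abs E0 - abs E) ≤ 2 * K1 := by
    have h4 : |e * E0| = |E0| := by rw [abs_mul]; rcases he with rfl | rfl <;> simp
    rw [← h4]
    refine (abs_abs_sub_abs_le _ _).trans ?_
    rw [abs_le] at h2 ⊢
    omega
  rw [hE0, hE, ← mul_sub] at h3
  have hM0 : 0 < M := by have := abs_nonneg q; omega
  rw [abs_mul, abs_of_pos hM0] at h3
  by_contra hne
  have : 1 ≤ |i - j| := Int.one_le_abs (sub_ne_zero.2 hne)
  nlinarith

lemma eps_one {M K1 e E0 q : ℤ} (hM : 2 * K1 < M) (he : e = 1 ∨ e = -1)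
    (h1 : |q| ≤ K1) (h2 : |e * E0 + q - E0| ≤ K1) (hE0 : M ≤ |E0|) : e = 1 := by
  rcases he with rfl | rfl
  · rfl
  · exfalso
    rw [abs_le] at h1 h2
    have : |E0| ≤ K1 := by rw [abs_le]; omega
    omega

variable {α : Type*} [DecidableEq α] {ι : Fin 2 → α} {D : List (α × Bool)} {M : ℤ}

lemma final_alg {z : α} (A : Subgroup (MulAut (FreeGroup α)))
    (hLe : (MulAut.conj : FreeGroup α →* MulAut (FreeGroup α)).range ≤ A)
    (hFin : ((MulAut.conj : FreeGroup α →* MulAut (FreeGroup α)).range.subgroupOf A).FiniteIndex)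
    (d : FreeGroup α)
    (hd : ∀ p q : ℤ, nm (FreeGroup.of z ^ p * d * FreeGroup.of z ^ q) = |p| + nm d + |q|)
    (hG : ∀ a ∈ A, a (FreeGroup.of z) = FreeGroup.of z → IsOfFinOrder a → a d = d → a = 1)
    (s : MulAut (FreeGroup α)) (g X0 Y0 X1 Y1 : FreeGroup α) (p : ℤ)
    (hX : X1 = X0 * FreeGroup.of z ^ p * d) (hY : Y1 = Y0 * FreeGroup.of z ^ p * d)
    (haA : MulAut.conj g * s ∈ A)
    (h0 : (Y0⁻¹ * (g * s X0)) * s (FreeGroup.of z) * (Y0⁻¹ * (g * s X0))⁻¹ = FreeGroup.of z)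
    (h1 : (Y1⁻¹ * (g * s X1)) * s (FreeGroup.of z) * (Y1⁻¹ * (g * s X1))⁻¹ = FreeGroup.of z) :
    MulAut.conj g * s = MulAut.conj (Y1 * X1⁻¹) := by
  set Z := FreeGroup.of z with hZ
  set g0 := Y0⁻¹ * (g * s X0) with hg0
  set g1 := Y1⁻¹ * (g * s X1) with hg1
  have e0 : g0 * s (Z ^ p) = Z ^ p * g0 := by
    have := zpow_conj (z := z) (s := s) (g' := g0) (e := 1) (by rw [zpow_one]; exact h0) p
    rwa [one_mul] at this
  have e1 : g1 = (d⁻¹ * (g0 * s d * g0⁻¹)) * g0 := by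
    have : g1 = d⁻¹ * Z ^ (-p) * (g0 * s (Z ^ p)) * s d := by
      rw [hg1, hg0, hX, hY, map_mul, map_mul]; group
    rw [this, e0]; group
  set v := d⁻¹ * (g0 * s d * g0⁻¹) with hv
  have e2 : v * Z ^ (1 : ℤ) * v⁻¹ = Z ^ (1 : ℤ) := by
    rw [zpow_one]
    have h1' := h1
    rw [e1] at h1'
    calc v * Z * v⁻¹ = v * (g0 * s Z * g0⁻¹) * v⁻¹ := by rw [h0]
      _ = v * g0 * s Z * (v * g0)⁻¹ := by group
      _ = Z := h1'
  obtain ⟨j, hj⟩ := centr (z := z) (s := v) (by omega) e2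
  rw [← hZ] at hj
  have haA2 : MulAut.conj g1 * s ∈ A := by
    have : MulAut.conj g1 * s = MulAut.conj (g1 * g⁻¹) * (MulAut.conj g * s) := by
      rw [← mul_assoc, ← map_mul]; congr 2; group
    rw [this]
    exact A.mul_mem (hLe ⟨_, rfl⟩) haA
  have h5 := fix_final A hFin d hd hG (MulAut.conj g1 * s) haA2 (by
    rw [MulAut.mul_apply, MulAut.conj_apply]; exact h1) j (by
    rw [MulAut.mul_apply, MulAut.conj_apply, e1]
    have : v * g0 * s d * (v * g0)⁻¹ = v * (d * v) * v⁻¹ := by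
      rw [hv]; group
    rw [this, hj, ← hZ]; group)
  have h6 : MulAut.conj g1 * s = (MulAut.conj Y1)⁻¹ * (MulAut.conj g * s) * MulAut.conj X1 := by
    refine MulEquiv.ext fun x => ?_
    rw [← map_inv]
    simp only [hg1, MulAut.mul_apply, MulAut.conj_apply, map_mul, map_inv, mul_inv_rev, inv_inv,
      mul_assoc]
  rw [h6] at h5
  rw [map_mul, map_inv, eq_mul_inv_iff_mul_eq]
  calc MulAut.conj g * s * MulAut.conj X1 = MulAut.conj Y1 * ((MulAut.conj Y1)⁻¹ *
        (MulAut.conj g * s) * MulAut.conj X1) := by group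
    _ = MulAut.conj Y1 := by rw [h5, mul_one]

variable (hι : Function.Injective ι) (hD : FreeGroup.IsReduced D) (hD1 : D.head? = some (ι 1, true))
  (hD2 : D.getLast? = some (ι 1, true))

include hι hD hD1 hD2

lemma claimM [Finite α] {lam C K K1 : ℤ} {s : MulAut (FreeGroup α)} (hlam : 1 ≤ lam) (hC : 0 ≤ C)
    (hs : Good lam C s) (A : Subgroup (MulAut (FreeGroup α)))
    (hLe : (MulAut.conj : FreeGroup α →* MulAut (FreeGroup α)).range ≤ A)
    (hFin : ((MulAut.conj : FreeGroup α →* MulAut (FreeGroup α)).range.subgroupOf A).FiniteIndex)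
    (hG : ∀ a ∈ A, a (FreeGroup.of (ι 0)) = FreeGroup.of (ι 0) → IsOfFinOrder a →
        a (FreeGroup.mk D) = FreeGroup.mk D → a = 1)
    (hK : K = 2 * D.length + 3) (hK1 : K1 = 2 * (C + K) + C) (Wc : ℕ)
    (hcard : 3 * (ball_finite (α := α) (C + K)).toFinset.card < Wc + 1)
    (hM1 : 2 * (C + K) + lam * Wc < M) (hM2 : (Wc : ℤ) ≤ M)
    (hM3 : 2 * (K1 + (C + K)) + lam * D.length < M) (hM4 : 2 * K1 < M)
    (g : FreeGroup α) (haA : MulAut.conj g * s ∈ A) (w w' : FreeGroup (Fin 2)) (hw : w ≠ 1)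
    (hww : (MulAut.conj g * s) (rho ι D M w) = rho ι D M w') :
    ∃ γ, MulAut.conj g * s = MulAut.conj (rho ι D M γ) := by
  set b := 2 * nm g + 2 * C + K + lam * Wc + 5 * M + 1 with hb
  obtain ⟨k, hkb⟩ : ∃ k : ℕ, lam * b ≤ k := ⟨(lam * b).toNat, Int.self_le_toNat _⟩
  obtain ⟨m, hm⟩ := exists_pow_big hw (2 * k + 1)
  have hM0 : 0 ≤ M := by omega
  have hw'm : w' ^ m ≠ 1 := by
    intro h
    have h1 : (MulAut.conj g * s) (rho ι D M (w ^ m)) = 1 := by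
      rw [map_pow, map_pow, hww, ← map_pow, h, map_one]
    have h2 : rho ι D M (w ^ m) = 1 := (MulEquiv.map_eq_one_iff _).1 h1
    have h3 : w ^ m = 1 := (rho_inj hι hD hD1 hD2) (by rw [h2, map_one])
    rw [h3] at hm
    simp at hm
  obtain ⟨W, hW⟩ : ∃ W, W = (w ^ m).toWord := ⟨_, rfl⟩
  obtain ⟨W', hW'⟩ : ∃ W', W' = (w' ^ m).toWord := ⟨_, rfl⟩
  have hWr : FreeGroup.IsReduced W := by rw [hW]; exact FreeGroup.isReduced_toWord
  have hWr' : FreeGroup.IsReduced W' := by rw [hW']; exact FreeGroup.isReduced_toWord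
  rw [← hW] at hm
  have hW0 : W ≠ [] := by rintro h; rw [h] at hm; simp at hm
  have hW'0 : W' ≠ [] := by rw [hW']; simpa using hw'm
  have r0 := runs (M := M) hι hD hD1 hD2 hM0 hWr hW0
  have r1 := runs (M := M) hι hD hD1 hD2 hM0 hWr' hW'0
  rw [← hK] at r0 r1
  set f0 := rho ι D M (FreeGroup.mk W) with hf0
  set f := rho ι D M (FreeGroup.mk W') with hf
  have hfg : g * s f0 = f * g := by
    have : (MulAut.conj g * s) f0 = f := by
      rw [hf0, hf, hW, hW', FreeGroup.mk_toWord, FreeGroup.mk_toWord, map_pow, map_pow, hww, ← map_pow]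
    rw [MulAut.mul_apply, MulAut.conj_apply] at this
    rw [← this]; group
  have dp0 := deep (M := M) (n := 3 * k) (k := k) hι hD hD1 hD2
    hWr (by omega) (by omega)
  have dp1 := deep (M := M) (n := 3 * k + 1) (k := k) hι hD hD1 hD2
    hWr (by omega) (by omega)
  rw [← hf0] at dp0 dp1
  obtain ⟨n0, hn0, e0, he0, q0, u0, hu0, hq0, hz0, hb0, hc0⟩ := corr hlam hs r0 r1 Wc hfg hM1 hM2 hcard
    hC (by omega) hb (3 * k) (by omega) (by omega) (by omega)
  obtain ⟨n1, hn1, e1, he1, q1, u1, hu1, hq1, hz1, hb1, hc1⟩ := corr hlam hs r0 r1 Wc hfg hM1 hM2 hcard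
    hC (by omega) hb (3 * k + 1) (by omega) (by omega) (by omega)
  rw [← hK1] at hb0 hc0 hb1 hc1
  have m0 : (3 * k) % 3 = 0 := by omega
  have m1 : (3 * k + 1) % 3 = 1 := by omega
  have blk : bl W (3 * k + 1) = bl W (3 * k) := by
    unfold bl; congr 1; omega
  set c := bl W (3 * k) with hc
  have E0 : Er M W (3 * k) = ev M c 0 := by rw [Er, m0]
  have E1 : Er M W (3 * k + 1) = ev M c 1 := by rw [Er, m1, blk]
  rw [E0] at hc0
  rw [E1] at hc1
  have X1 := Yr_one (M := M) hι hD hD1 hD2 (W := W) m0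
  rw [← hc, E0] at X1
  -- run one goes to a run of type one
  have t1 := abs_ab hM4 he1 hb1 hc1 (abs_ev hM0 c 1) (abs_ev hM0 (bl W' n1) (n1 % 3))
  have t1' : n1 % 3 = 1 := ab_one (Nat.mod_lt _ (by omega)) t1.symm
  have t0 := abs_ab hM4 he0 hb0 hc0 (abs_ev hM0 c 0) (abs_ev hM0 (bl W' n0) (n0 % 3))
  -- adjacency
  have d1 : ds (g * s (Yr ι D M W (3 * k + 1))) (Yr ι D M W' n1) ≤ K1 + (C + K) := by
    rw [ds_comm, ds, hq1]
    have := nm_mul_le (FreeGroup.of (ι 0) ^ q1) u1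
    rw [nm_zpow] at this
    omega
  have d0 : ds (g * s (Yr ι D M W (3 * k) * FreeGroup.of (ι 0) ^ (ev M c 0)))
      (Yr ι D M W' n0 * FreeGroup.of (ι 0) ^ (Er M W' n0)) ≤ K1 + (C + K) := by
    rw [ds_comm, ds]
    have e3 : (Yr ι D M W' n0 * FreeGroup.of (ι 0) ^ (Er M W' n0))⁻¹ *
        (g * s (Yr ι D M W (3 * k) * FreeGroup.of (ι 0) ^ (ev M c 0))) =
        FreeGroup.of (ι 0) ^ (e0 * ev M c 0 + q0 - Er M W' n0) * u0 := by
      have e4 := zpow_conj hz0 (ev M c 0)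
      have e5 : (Yr ι D M W' n0 * FreeGroup.of (ι 0) ^ (Er M W' n0))⁻¹ *
        (g * s (Yr ι D M W (3 * k) * FreeGroup.of (ι 0) ^ (ev M c 0))) =
        FreeGroup.of (ι 0) ^ (- Er M W' n0) * ((Yr ι D M W' n0)⁻¹ * (g * s (Yr ι D M W (3 * k))) *
          s (FreeGroup.of (ι 0) ^ (ev M c 0))) := by
        rw [map_mul]; group
      rw [e5, e4, hq0, ← mul_assoc, ← mul_assoc, ← zpow_add, ← zpow_add]
      congr 2; ring
    rw [e3]
    have := nm_mul_le (FreeGroup.of (ι 0) ^ (e0 * ev M c 0 + q0 - Er M W' n0)) u0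
    rw [nm_zpow] at this
    omega
  have d2 : ds (g * s (Yr ι D M W (3 * k) * FreeGroup.of (ι 0) ^ (ev M c 0)))
      (g * s (Yr ι D M W (3 * k + 1))) ≤ lam * D.length := by
    rw [X1, map_mul s (_ * _), ds_mul_left, ds_mul_right]
    refine (hs.1 _).trans ?_
    rw [nm_mk (Dc_red hD hD1 hD2 _), Dc_length]
  have d3 : ds (Yr ι D M W' n1) (Yr ι D M W' n0 * FreeGroup.of (ι 0) ^ (Er M W' n0)) < M := by
    have t1 := ds_tri (Yr ι D M W' n1) (g * s (Yr ι D M W (3 * k + 1)))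
      (Yr ι D M W' n0 * FreeGroup.of (ι 0) ^ (Er M W' n0))
    have t2 := ds_tri (g * s (Yr ι D M W (3 * k + 1)))
      (g * s (Yr ι D M W (3 * k) * FreeGroup.of (ι 0) ^ (ev M c 0)))
      (Yr ι D M W' n0 * FreeGroup.of (ι 0) ^ (Er M W' n0))
    rw [ds_comm (Yr ι D M W' n1) (g * _)] at t1
    rw [ds_comm (g * s (Yr ι D M W (3 * k + 1))) (g * _)] at t2
    linarith
  have bE : ∀ E : ℤ, btw E E := fun E => by unfold btw; omega
  have b0 : ∀ E : ℤ, btw 0 E := fun E => by unfold btw; omega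
  have d4 := r1.dist n1 hn1 n0 hn0 0 (Er M W' n0) (b0 _) (bE _)
  rw [zpow_zero, mul_one, abs_zero, add_zero] at d4
  rw [d4] at d3
  have d5 := abs_lt.1 d3
  have bg := r1.big n0 hn0
  have hadj : n0 + 1 = n1 := by
    rcases lt_trichotomy (n0 + 1) n1 with h | h | h
    · have := r1.gap n0 n1 h hn1
      omega
    · exact h
    · exfalso
      rcases eq_or_lt_of_le (by omega : n1 ≤ n0) with h2 | h2
      · subst h2; omega
      · have := r1.mono n1 n0 h2 hn0
        have := abs_nonneg (Er M W' n1)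
        omega
  have m3 : n0 % 3 = 0 := by omega
  have blk' : bl W' n1 = bl W' n0 := by
    unfold bl; congr 1; omega
  rw [m3] at t0
  have hcc : c = bl W' n0 := idx_inj t0
  have E0' : Er M W' n0 = ev M c 0 := by rw [Er, m3, ← hcc]
  have E1' : Er M W' n1 = ev M c 1 := by rw [Er, t1', blk', ← hcc]
  rw [E0'] at hc0
  rw [E1'] at hc1
  have hE0M : M ≤ |ev M c 0| := by rw [← E0']; exact bg
  have hE1M : M ≤ |ev M c 1| := by rw [← E1']; exact r1.big n1 hn1
  have ee0 := eps_one hM4 he0 hb0 hc0 hE0M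
  have ee1 := eps_one hM4 he1 hb1 hc1 hE1M
  rw [ee0, zpow_one] at hz0
  rw [ee1, zpow_one] at hz1
  have Y1 := Yr_one (M := M) hι hD hD1 hD2 (W := W') m3
  rw [← hcc, E0', hadj] at Y1
  have fin := final_alg A hLe hFin (FreeGroup.mk (Dc D c.2)) (nm_zdz hι hD hD1 hD2 c.2) (by
    intro a ha1 ha2 ha3 ha4
    refine hG a ha1 ha2 ha3 ?_
    cases hcs : c.2 with
    | true => rw [hcs] at ha4; exact ha4
    | false => rw [hcs, mk_Dc_false, map_inv, inv_inj] at ha4; exact ha4)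
    s g _ _ _ _ (ev M c 0) X1 Y1 haA hz0 hz1
  refine ⟨FreeGroup.mk (W'.take (n1 / 3)) * (FreeGroup.mk (W.take ((3 * k + 1) / 3)))⁻¹, ?_⟩
  have key : rho ι D M (FreeGroup.mk (W'.take (n1 / 3)) *
      (FreeGroup.mk (W.take ((3 * k + 1) / 3)))⁻¹) =
      rho ι D M (FreeGroup.mk (W'.take (n1 / 3))) *
      (rho ι D M (FreeGroup.mk (W.take ((3 * k + 1) / 3))))⁻¹ := by rw [map_mul, map_inv]
  rw [fin, key, rho_mk, rho_mk]
  congr 1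
  unfold Yr Aw
  rw [blk', ← hcc, blk, t1', m1, mk_append, mk_append]
  group

end Final
end Kap


/-- Lemma 4.3 (kap2): Let `F` be a non-abelian free group of finite rank
(`F = FreeGroup (Fin r)` with `r ≥ 2`), let `H₁, …, Hₙ` be finitely generated
subgroups of infinite index, and let `A ≤ Aut F` be the preimage of a finite
subgroup `U ≤ Out F` under the projection `π : Aut F → Out F`; concretely,
`A` is a subgroup of `Aut F` containing all inner automorphisms, in which the
inner automorphisms have finite index.  Then there is a proper subgroup `H`
of `F` which is free of rank two and malnormal in `F`, such that
`Hₗ ∩ a(H)` is trivial for all `l` and all `a ∈ A`, and such that for every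
`a ∈ A` either `a(H) = H` or `H ∩ a(H)` is trivial. -/
theorem kap2 (r : ℕ) (hr : 2 ≤ r) (n : ℕ)
    (Hl : Fin n → Subgroup (FreeGroup (Fin r)))
    (hfg : ∀ l, (Hl l).FG) (hinf : ∀ l, ¬ (Hl l).FiniteIndex)
    (A : Subgroup (MulAut (FreeGroup (Fin r))))
    (hInnLe : (MulAut.conj :
        FreeGroup (Fin r) →* MulAut (FreeGroup (Fin r))).range ≤ A)
    (hInnFin : ((MulAut.conj :
        FreeGroup (Fin r) →* MulAut (FreeGroup (Fin r))).range.subgroupOf A).FiniteIndex) :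
    ∃ H : Subgroup (FreeGroup (Fin r)), H ≠ ⊤ ∧
      (Nonempty (H ≃* FreeGroup (Fin 2)) ∧ Malnormal H) ∧
      (∀ (l : Fin n), ∀ a ∈ A, Hl l ⊓ H.map a.toMonoidHom = ⊥) ∧
      (∀ a ∈ A, H.map a.toMonoidHom = H ∨ H ⊓ H.map a.toMonoidHom = ⊥) := by
  obtain ⟨S, hS, hSA⟩ := Kap.exists_reps A hInnFin
  obtain ⟨lam, C, hlam, hC, hst⟩ := Kap.unif_stab S hS
  obtain ⟨lamN, hlamN, hq⟩ := Kap.unif_qconvex Hl hfg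
  obtain ⟨ι, hι⟩ : ∃ ι : Fin 2 → Fin r, Function.Injective ι :=
    ⟨Fin.castLE hr, Fin.castLE_injective hr⟩
  have hzb : ι 0 ≠ ι 1 := fun h => absurd (hι h) (by decide)
  obtain ⟨D, hD, hD1, hD2, hDH, hDA⟩ :=
    Kap.choose_D hzb A hInnFin S hS Hl hinf (C + lamN)
  obtain ⟨K, hK⟩ : ∃ K : ℤ, K = 2 * D.length + 3 := ⟨_, rfl⟩
  obtain ⟨K1, hK1⟩ : ∃ K1 : ℤ, K1 = 2 * (C + K) + C := ⟨_, rfl⟩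
  obtain ⟨Wc, hWc⟩ : ∃ Wc : ℕ, 3 * (Kap.ball_finite (α := Fin r) (C + K)).toFinset.card < Wc + 1 :=
    ⟨_, Nat.lt_succ_self _⟩
  have p1 : 0 ≤ lam * (D.length : ℤ) := by positivity
  have p2 : 0 ≤ lam * (Wc : ℤ) := by positivity
  obtain ⟨M, hM⟩ : ∃ M : ℤ, M = 2 * (K1 + (C + K)) + lam * D.length + 2 * (C + K) + lam * Wc + Wc
    + 2 * K1 + 1 := ⟨_, rfl⟩
  have key : ∀ a ∈ A, ∀ w w', w ≠ 1 → a (Kap.rho ι D M w) = Kap.rho ι D M w' →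
      ∃ γ, a = MulAut.conj (Kap.rho ι D M γ) := by
    intro a ha w w' hw hww
    obtain ⟨s, hs, g, rfl⟩ := hSA a ha
    exact Kap.claimM hι hD hD1 hD2 hlam hC (hst s hs) A hInnLe hInnFin hDA hK hK1 Wc hWc
      (by omega) (by omega) (by omega) (by omega) g ha w w' hw hww
  have key2 : ∀ a ∈ A, ∀ x, x ∈ (Kap.rho ι D M).range → x ≠ 1 →
      x ∈ (Kap.rho ι D M).range.map a.toMonoidHom → ∃ γ, a = MulAut.conj (Kap.rho ι D M γ) := by
    rintro a ha _ ⟨w', rfl⟩ hx ⟨_, ⟨w, rfl⟩, hw⟩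
    refine key a ha w w' ?_ hw
    rintro rfl
    apply hx
    rw [← hw, map_one, map_one]
  refine ⟨(Kap.rho ι D M).range, Kap.rho_ne_top hι hD hD1 hD2,
    ⟨⟨(MonoidHom.ofInjective (Kap.rho_inj hι hD hD1 hD2)).symm⟩, ?_⟩, ?_, ?_⟩
  · intro g hg
    rw [Subgroup.eq_bot_iff_forall]
    rintro x ⟨hx1, hx2⟩
    by_contra hx
    obtain ⟨γ, hγ⟩ := key2 (MulAut.conj g) (hInnLe ⟨g, rfl⟩) x hx1 hx hx2
    apply hg
    have h1 : MulAut.conj ((Kap.rho ι D M γ)⁻¹ * g) = 1 := by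
      rw [map_mul, hγ, map_inv, inv_mul_cancel]
    have h2 := Kap.conj_inj hzb h1
    exact ⟨γ, inv_mul_eq_one.1 h2⟩
  · intro l a ha
    rw [Subgroup.eq_bot_iff_forall]
    rintro x ⟨hx1, _, ⟨w, rfl⟩, rfl⟩
    by_cases hw : w = 1
    · rw [hw, map_one, map_one]
    · exfalso
      obtain ⟨s, hs, g, rfl⟩ := hSA a ha
      exact Kap.claimN hι hD hD1 hD2 hlam (hst s hs) (Hl l) (hq l) (hDH s hs l) g w hw hx1
  · intro a ha
    by_cases h : (Kap.rho ι D M).range ⊓ (Kap.rho ι D M).range.map a.toMonoidHom = ⊥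
    · exact Or.inr h
    · left
      rw [Subgroup.eq_bot_iff_forall] at h
      push Not at h
      obtain ⟨x, ⟨hx1, hx2⟩, hx⟩ := h
      obtain ⟨γ, rfl⟩ := key2 a ha x hx1 hx hx2
      ext y
      constructor
      · rintro ⟨_, ⟨w, rfl⟩, rfl⟩
        refine ⟨γ * w * γ⁻¹, ?_⟩
        rw [map_mul, map_mul, map_inv]
        rfl
      · rintro ⟨w, rfl⟩
        refine ⟨_, ⟨γ⁻¹ * w * γ, rfl⟩, ?_⟩
        change Kap.rho ι D M γ * Kap.rho ι D M (γ⁻¹ * w * γ) * (Kap.rho ι D M γ)⁻¹ = _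
        rw [← map_inv, ← map_mul, ← map_mul]
        congr 1
        group
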